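/- The grid net G_3 has no pure wiring decomposition of width strictly less than 3; in particular there is no pure ';'-decomposition of G_3 of width less than 3. -/

import Mathlib

/-! Core definitions: nets with boundaries (Sobocinski et al.),
composition, tensor, isomorphism, step firing semantics, ports,
connections, networks, bases, wiring expressions and decompositions. -/

namespace NWB

/-- A net with boundaries `N : k → l` (without the contention axioms,
which are packaged separately in `IsContention`). -/
structure NetB (k l : ℕ) : Type 1 where
  P : Type
  T : Type
  finP : Finite P
  finT : Finite T
  pre : T → Set P
  post : T → Set P
  src : T → Set (Fin k)
  tgt : T → Set (Fin l)
  con : T → T → Prop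

/-- The contention relation axioms: reflexive, symmetric, and forced whenever
two transitions share a pre-place, post-place, or boundary port. -/
def IsContention {k l : ℕ} (N : NetB k l) : Prop :=
  (∀ t, N.con t t) ∧ (∀ t u, N.con t u → N.con u t) ∧
  (∀ t u,
    ((N.pre t ∩ N.pre u).Nonempty ∨ (N.post t ∩ N.post u).Nonempty ∨
     (N.src t ∩ N.src u).Nonempty ∨ (N.tgt t ∩ N.tgt u).Nonempty) → N.con t u)

def setPre {k l : ℕ} (N : NetB k l) (U : Set N.T) : Set N.P := ⋃ u ∈ U, N.pre u
def setPost {k l : ℕ} (N : NetB k l) (U : Set N.T) : Set N.P := ⋃ u ∈ U, N.post u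
def setSrc {k l : ℕ} (N : NetB k l) (U : Set N.T) : Set (Fin k) := ⋃ u ∈ U, N.src u
def setTgt {k l : ℕ} (N : NetB k l) (U : Set N.T) : Set (Fin l) := ⋃ u ∈ U, N.tgt u

/-- Mutually independent set of transitions: no two distinct members in contention. -/
def MI {k l : ℕ} (N : NetB k l) (U : Set N.T) : Prop :=
  ∀ u ∈ U, ∀ v ∈ U, N.con u v → u = v

/-- Contention lifted to sets of transitions. -/
def setCon {k l : ℕ} (N : NetB k l) (U V : Set N.T) : Prop :=
  ∃ u ∈ U, ∃ v ∈ V, N.con u v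

/-- A synchronisation between `M : l → m` and `N : m → n`. -/
structure Sync {l m n : ℕ} (M : NetB l m) (N : NetB m n) where
  U : Set M.T
  V : Set N.T
  miU : MI M U
  miV : MI N V
  bd : setTgt M U = setSrc N V

def Sync.Trivial {l m n : ℕ} {M : NetB l m} {N : NetB m n} (s : Sync M N) : Prop :=
  s.U = ∅ ∧ s.V = ∅

/-- A minimal synchronisation: non-trivial, and every componentwise-smaller
synchronisation is trivial or equal to it. -/
def Sync.Minimal {l m n : ℕ} {M : NetB l m} {N : NetB m n} (s : Sync M N) : Prop :=
  ¬ s.Trivial ∧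
  ∀ s' : Sync M N, s'.U ⊆ s.U → s'.V ⊆ s.V → (s'.Trivial ∨ (s'.U = s.U ∧ s'.V = s.V))

theorem sync_finite {l m n : ℕ} (M : NetB l m) (N : NetB m n) : Finite (Sync M N) := by
  haveI := M.finT; haveI := N.finT
  apply Finite.of_injective (fun s : Sync M N => (s.U, s.V))
  intro s s' h
  simp only [Prod.mk.injEq] at h
  obtain ⟨h1, h2⟩ := h
  cases s; cases s'
  simp_all

/-- Composition along a common boundary. -/
def comp {l m n : ℕ} (M : NetB l m) (N : NetB m n) : NetB l n where
  P := M.P ⊕ N.P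
  T := {s : Sync M N // s.Minimal}
  finP := by haveI := M.finP; haveI := N.finP; exact inferInstance
  finT := by haveI := sync_finite M N; exact inferInstance
  pre s := (Sum.inl '' setPre M s.1.U) ∪ (Sum.inr '' setPre N s.1.V)
  post s := (Sum.inl '' setPost M s.1.U) ∪ (Sum.inr '' setPost N s.1.V)
  src s := setSrc M s.1.U
  tgt s := setTgt N s.1.V
  con s s' := setCon M s.1.U s'.1.U ∨ setCon N s.1.V s'.1.V

/-- Tensor product of nets with boundaries. -/
def tensor {l m k n : ℕ} (M : NetB l m) (N : NetB k n) : NetB (l + k) (m + n) where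
  P := M.P ⊕ N.P
  T := M.T ⊕ N.T
  finP := by haveI := M.finP; haveI := N.finP; exact inferInstance
  finT := by haveI := M.finT; haveI := N.finT; exact inferInstance
  pre t := match t with
    | Sum.inl t => Sum.inl '' M.pre t
    | Sum.inr t => Sum.inr '' N.pre t
  post t := match t with
    | Sum.inl t => Sum.inl '' M.post t
    | Sum.inr t => Sum.inr '' N.post t
  src t := match t with
    | Sum.inl t => Fin.castAdd k '' M.src t
    | Sum.inr t => Fin.natAdd l '' N.src t
  tgt t := match t with
    | Sum.inl t => Fin.castAdd n '' M.tgt t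
    | Sum.inr t => Fin.natAdd m '' N.tgt t
  con t u := match t, u with
    | Sum.inl t, Sum.inl u => M.con t u
    | Sum.inr t, Sum.inr u => N.con t u
    | _, _ => False

/-- Isomorphism of nets with boundaries: bijections on places and transitions
preserving pre-sets, post-sets, boundary maps and contention. -/
structure NetIso {k l : ℕ} (M N : NetB k l) where
  ep : M.P ≃ N.P
  et : M.T ≃ N.T
  pre_eq : ∀ t, N.pre (et t) = ep '' M.pre t
  post_eq : ∀ t, N.post (et t) = ep '' M.post t
  src_eq : ∀ t, N.src (et t) = M.src t
  tgt_eq : ∀ t, N.tgt (et t) = M.tgt t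
  con_iff : ∀ t u, N.con (et t) (et u) ↔ M.con t u

def Iso {k l : ℕ} (M N : NetB k l) : Prop := Nonempty (NetIso M N)

/-- Transport a net along equalities of its boundary sizes. -/
def castNet {k l k' l' : ℕ} (h1 : k = k') (h2 : l = l') (N : NetB k l) : NetB k' l' where
  P := N.P
  T := N.T
  finP := N.finP
  finT := N.finT
  pre := N.pre
  post := N.post
  src t := Fin.cast h1 '' N.src t
  tgt t := Fin.cast h2 '' N.tgt t
  con := N.con

def emptyNet : NetB 0 0 where
  P := Empty
  T := Empty
  finP := inferInstance
  finT := inferInstance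
  pre t := t.elim
  post t := t.elim
  src t := t.elim
  tgt t := t.elim
  con t _ := t.elim

/-- The step firing semantics: `Fires N X X' α β` iff the LTS `⟦N⟧` has a
transition `X →⟨α,β⟩ X'`. -/
def Fires {k l : ℕ} (N : NetB k l) (X X' : Set N.P) (α : Set (Fin k)) (β : Set (Fin l)) :
    Prop :=
  ∃ U : Set N.T, MI N U ∧ setPre N U ⊆ X ∧ setPost N U ∩ X = ∅ ∧
    X' = (X \ setPre N U) ∪ setPost N U ∧ setSrc N U = α ∧ setTgt N U = β

/-! ### Ports, connections and networks -/

/-- The ports of a net: an in-port and an out-port for each place,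
together with the left and right boundary ports. -/
def Port {k l : ℕ} (N : NetB k l) : Type := (N.P ⊕ N.P) ⊕ (Fin k ⊕ Fin l)

def portIn {k l : ℕ} {N : NetB k l} (p : N.P) : Port N := Sum.inl (Sum.inl p)
def portOut {k l : ℕ} {N : NetB k l} (p : N.P) : Port N := Sum.inl (Sum.inr p)
def bLeft {k l : ℕ} {N : NetB k l} (i : Fin k) : Port N := Sum.inr (Sum.inl i)
def bRight {k l : ℕ} {N : NetB k l} (j : Fin l) : Port N := Sum.inr (Sum.inr j)

/-- The portset of a transition. -/
def tports {k l : ℕ} (N : NetB k l) (t : N.T) : Set (Port N) :=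
  (portOut '' N.pre t) ∪ (portIn '' N.post t) ∪ (bLeft '' N.src t) ∪ (bRight '' N.tgt t)

/-- The connection of a port `q`: the portsets (minus `q`) of all transitions
properly connecting to `q`. -/
def conn {k l : ℕ} (N : NetB k l) (q : Port N) : Set (Set (Port N)) :=
  { K | ∃ t : N.T, {q} ⊂ tports N t ∧ K = tports N t \ {q} }

/-- The connection of `q` restricted to a set `R` of ports. -/
def connR {k l : ℕ} (N : NetB k l) (R : Set (Port N)) (q : Port N) :
    Set (Set (Port N)) :=
  { K' | ∃ K ∈ conn N q, (K ∩ R).Nonempty ∧ K' = K ∩ R }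

/-- Extended ports of the left part of an oriented partition. -/
def eportsL {k l : ℕ} (N : NetB k l) (Pl : Set N.P) : Set (Port N) :=
  (portIn '' Pl) ∪ (portOut '' Pl) ∪ Set.range (bLeft (N := N))

/-- Extended ports of the right part of an oriented partition. -/
def eportsR {k l : ℕ} (N : NetB k l) (Pr : Set N.P) : Set (Port N) :=
  (portIn '' Pr) ∪ (portOut '' Pr) ∪ Set.range (bRight (N := N))

/-- The network `net(P_l → P_r)`. -/
def networkLR {k l : ℕ} (N : NetB k l) (Pl Pr : Set N.P) :
    Set (Set (Set (Port N))) :=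
  { c | ∃ q ∈ eportsL N Pl, c = connR N (eportsR N Pr) q }

/-- The network `net(P_r → P_l)`. -/
def networkRL {k l : ℕ} (N : NetB k l) (Pl Pr : Set N.P) :
    Set (Set (Set (Port N))) :=
  { c | ∃ q ∈ eportsR N Pr, c = connR N (eportsL N Pl) q }

/-- `b` is a basis of the network `M`: every connection in `M` is a union of
basis connections. -/
def IsBasis {C : Type} {m : ℕ} (b : Fin m → Set C) (M : Set (Set C)) : Prop :=
  ∀ c ∈ M, ∃ S : Finset (Fin m), c = ⋃ i ∈ S, b i

/-- The dimension of a network: the size of its smallest basis. -/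
noncomputable def netDim {C : Type} (M : Set (Set C)) : ℕ :=
  sInf { m | ∃ b : Fin m → Set C, IsBasis b M }

/-- Purity of a composition `N_l ; N_r`: no transition of either component
connects to two different shared boundary ports. -/
def Pure {k n l : ℕ} (Nl : NetB k n) (Nr : NetB n l) : Prop :=
  (∀ j : Fin n, ∀ K ∈ conn Nl (bRight j), ∀ i : Fin n, bRight i ∉ K) ∧
  (∀ j : Fin n, ∀ K ∈ conn Nr (bLeft j), ∀ i : Fin n, bLeft i ∉ K)

/-! ### Wiring expressions and decompositions -/

/-- Nets with boundaries of arbitrary boundary sizes. -/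
def NetS : Type 1 := Σ (k : ℕ) (l : ℕ), NetB k l

/-- Composition on `NetS` (junk value on boundary mismatch). -/
def seqS (X Y : NetS) : NetS :=
  if h : X.2.1 = Y.1 then ⟨X.1, Y.2.1, comp (castNet rfl h X.2.2) Y.2.2⟩
  else ⟨0, 0, emptyNet⟩

def tenS (X Y : NetS) : NetS := ⟨X.1 + Y.1, X.2.1 + Y.2.1, tensor X.2.2 Y.2.2⟩

/-- Wiring expressions: binary trees with `;` and `⊗` nodes and variables at
the leaves. -/
inductive WExpr (V : Type) : Type
  | leaf : V → WExpr V
  | seq : WExpr V → WExpr V → WExpr V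
  | ten : WExpr V → WExpr V → WExpr V

/-- Semantics of a wiring expression under a variable assignment. -/
def sem {V : Type} (A : V → NetS) : WExpr V → NetS
  | .leaf x => A x
  | .seq t₁ t₂ => seqS (sem A t₁) (sem A t₂)
  | .ten t₁ t₂ => tenS (sem A t₁) (sem A t₂)

/-- Compatibility of an assignment with an expression: at each `;` node the
shared boundaries match. -/
def WT {V : Type} (A : V → NetS) : WExpr V → Prop
  | .leaf _ => True
  | .seq t₁ t₂ => WT A t₁ ∧ WT A t₂ ∧ (sem A t₁).2.1 = (sem A t₂).1
  | .ten t₁ t₂ => WT A t₁ ∧ WT A t₂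

/-- The wiring decomposition `(t, A)` has width `w`: every leaf net has
boundaries and number of places `≤ w`, and every subexpression has
boundaries `≤ w`. -/
def HasWidth {V : Type} (A : V → NetS) (w : ℕ) : WExpr V → Prop
  | .leaf x => (A x).1 ≤ w ∧ Nat.card (A x).2.2.P ≤ w ∧ (A x).2.1 ≤ w
  | .seq t₁ t₂ => HasWidth A w t₁ ∧ HasWidth A w t₂ ∧
      (sem A (.seq t₁ t₂)).1 ≤ w ∧ (sem A (.seq t₁ t₂)).2.1 ≤ w
  | .ten t₁ t₂ => HasWidth A w t₁ ∧ HasWidth A w t₂ ∧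
      (sem A (.ten t₁ t₂)).1 ≤ w ∧ (sem A (.ten t₁ t₂)).2.1 ≤ w

/-- `(t, A)` is a wiring decomposition of `N : k → l`: the assignment maps
variables to genuine nets with boundaries, is compatible with `t`, and
`⟦t⟧_A ≅ N`. -/
def IsDecompOf {V : Type} {k l : ℕ} (A : V → NetS) (t : WExpr V) (N : NetB k l) : Prop :=
  (∀ x, IsContention (A x).2.2) ∧ WT A t ∧
  ∃ (h1 : (sem A t).1 = k) (h2 : (sem A t).2.1 = l),
    Iso (castNet h1 h2 (sem A t).2.2) N

/-- A net has decomposition width `w` if it has a wiring decomposition of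
width `w`. -/
def HasDecompWidth {k l : ℕ} (N : NetB k l) (w : ℕ) : Prop :=
  ∃ (Var : Type) (A : Var → NetS) (t : WExpr Var),
    IsDecompOf A t N ∧ HasWidth A w t

/-- A pure wiring decomposition: at every `;` node the composition of the two
subexpression nets is pure. -/
def PureExpr {V : Type} (A : V → NetS) : WExpr V → Prop
  | .leaf _ => True
  | .seq t₁ t₂ => PureExpr A t₁ ∧ PureExpr A t₂ ∧
      ∀ (h : (sem A t₁).2.1 = (sem A t₂).1),
        Pure (castNet rfl h (sem A t₁).2.2) (sem A t₂).2.2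
  | .ten t₁ t₂ => PureExpr A t₁ ∧ PureExpr A t₂

/-- One step of reassociation of `;` or `⊗`, anywhere inside an expression. -/
inductive AssocStep {V : Type} : WExpr V → WExpr V → Prop
  | seqAssoc (a b c : WExpr V) : AssocStep (.seq (.seq a b) c) (.seq a (.seq b c))
  | tenAssoc (a b c : WExpr V) : AssocStep (.ten (.ten a b) c) (.ten a (.ten b c))
  | seqCongrL {a a' : WExpr V} (b : WExpr V) :
      AssocStep a a' → AssocStep (.seq a b) (.seq a' b)
  | seqCongrR (a : WExpr V) {b b' : WExpr V} :
      AssocStep b b' → AssocStep (.seq a b) (.seq a b')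
  | tenCongrL {a a' : WExpr V} (b : WExpr V) :
      AssocStep a a' → AssocStep (.ten a b) (.ten a' b)
  | tenCongrR (a : WExpr V) {b b' : WExpr V} :
      AssocStep b b' → AssocStep (.ten a b) (.ten a b')

/-- Equivalence of wiring expressions up to associativity of `;` and `⊗`. -/
def AssocEquiv {V : Type} : WExpr V → WExpr V → Prop := Relation.EqvGen AssocStep

/-! ### Concrete families of nets -/

/-- The clique net `C_n : 0 → 0`, with the minimal contention relation. -/
def clique (n : ℕ) : NetB 0 0 where
  P := Fin n
  T := {p : Fin n × Fin n // p.1 ≠ p.2}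
  finP := inferInstance
  finT := inferInstance
  pre t := {t.1.1}
  post t := {t.1.2}
  src _ := ∅
  tgt _ := ∅
  con t u := t.1.1 = u.1.1 ∨ t.1.2 = u.1.2

/-- The subset net `P_n : 0 → 0`: a place `S` (= `none`), places `[n]`, and for
each `A ⊆ [n]` a transition `S → A`; the minimal contention relation is total
since all pre-sets are `{S}`. -/
def subsetNet (n : ℕ) : NetB 0 0 where
  P := Option (Fin n)
  T := Set (Fin n)
  finP := inferInstance
  finT := inferInstance
  pre _ := {none}
  post A := some '' A
  src _ := ∅
  tgt _ := ∅
  con _ _ := True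

/-- The tree net `T_Δ^{n,k} : 0 → 0`: places are nodes of the complete n-ary
tree of depth k (lists over `Fin n` of length ≤ k); each non-leaf node has a
single transition to the set of its n children. The minimal contention
relation is equality. -/
def treeD (n k : ℕ) : NetB 0 0 where
  P := {l : List (Fin n) // l.length ≤ k}
  T := {l : List (Fin n) // l.length < k}
  finP := (List.finite_length_le (Fin n) k).to_subtype
  finT := (List.finite_length_lt (Fin n) k).to_subtype
  pre t := {⟨t.1, t.2.le⟩}
  post t := {p | ∃ i : Fin n, p.1 = t.1 ++ [i]}
  src _ := ∅
  tgt _ := ∅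
  con t u := t = u

/-- The tree net `T_Λ^{n,k} : 0 → 0`: as `T_Δ^{n,k}` but with a separate
transition from each non-leaf node to each of its children. The minimal
contention relation relates transitions with the same parent node. -/
def treeL (n k : ℕ) : NetB 0 0 where
  P := {l : List (Fin n) // l.length ≤ k}
  T := {l : List (Fin n) // l.length < k} × Fin n
  finP := (List.finite_length_le (Fin n) k).to_subtype
  finT := by
    haveI : Finite {l : List (Fin n) // l.length < k} :=
      (List.finite_length_lt (Fin n) k).to_subtype
    exact inferInstance
  pre t := {⟨t.1.1, t.1.2.le⟩}
  post t := {p | p.1 = t.1.1 ++ [t.2]}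
  src _ := ∅
  tgt _ := ∅
  con t u := t.1 = u.1

/-- The grid net `G_n : 0 → 0`: places `[n] × [n]`, a transition from each
place to its right neighbour and to its lower neighbour; the minimal
contention relation relates transitions sharing a pre-place or post-place. -/
def grid (n : ℕ) : NetB 0 0 where
  P := Fin n × Fin n
  T := {e : (Fin n × Fin n) × (Fin n × Fin n) //
        (e.2.1 = e.1.1 ∧ (e.2.2 : ℕ) = (e.1.2 : ℕ) + 1) ∨
        ((e.2.1 : ℕ) = (e.1.1 : ℕ) + 1 ∧ e.2.2 = e.1.2)}
  finP := inferInstance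
  finT := inferInstance
  pre e := {e.1.1}
  post e := {e.1.2}
  src _ := ∅
  tgt _ := ∅
  con t u := t.1.1 = u.1.1 ∨ t.1.2 = u.1.2

end NWB

namespace NWB

/-! ### Finite combinatorics of the 3×3 grid, vertices coded as `0..8` -/

def gE : List (ℕ × ℕ) :=
  [(0,1),(1,2),(3,4),(4,5),(6,7),(7,8),(0,3),(1,4),(2,5),(3,6),(4,7),(5,8)]

/-- Configurations: whether it is the whole-grid configuration, the removed
corner, its two neighbours and the size threshold. -/
structure Cfg where
  g : Bool
  c : ℕ
  n1 : ℕ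
  n2 : ℕ
  th : ℕ

def cfgs : List Cfg :=
  [⟨true, 9, 0, 0, 3⟩, ⟨false, 0, 1, 3, 2⟩, ⟨false, 0, 3, 1, 2⟩, ⟨false, 8, 5, 7, 2⟩,
   ⟨false, 8, 7, 5, 2⟩]

def cntC (c : ℕ) (f : ℕ → Bool) : ℕ := (List.range 9).countP (fun i => f i && i != c)

def touch (s : ℕ → Bool) (e : ℕ × ℕ) : Bool := s e.1 || s e.2

def isE (p q : ℕ) (e : ℕ × ℕ) : Bool := (e.1 == p && e.2 == q) || (e.1 == q && e.2 == p)

def notAt (c : ℕ) (e : ℕ × ℕ) : Bool := e.1 != c && e.2 != c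

def known (k : Cfg) (a s b : ℕ → Bool) (e : ℕ × ℕ) : Bool :=
  touch s e || (notAt k.c e && ((a e.1 && b e.2) || (b e.1 && a e.2))) ||
  (!k.g && ((isE k.c k.n1 e && !a k.n1) || (isE k.c k.n2 e && !b k.n2)))

def badC (k : Cfg) (a s b : ℕ → Bool) (r : ℕ × ℕ → Bool) : Bool :=
  (List.range 9).all (fun i => i == k.c || a i || s i || b i) &&
  (k.g || !s k.c) &&
  decide (cntC k.c a ≤ k.th) && decide (cntC k.c b ≤ k.th) &&
  (k.g || ((a k.n1 || a k.c) && (b k.n2 || b k.c))) &&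
  gE.all (fun e => !known k a s b e || r e)

/-- Known edges crossing the cut between `f` and its complement. -/
def midE (k : Cfg) (f : ℕ → Bool) (e : ℕ × ℕ) : Bool :=
  (notAt k.c e && (f e.1 != f e.2)) ||
  (!k.g && ((isE k.c k.n1 e && !f k.n1) || (isE k.c k.n2 e && f k.n2)))

def shareT (t u : Bool × ℕ × ℕ) : Bool :=
  t.1 == u.1 && (t.2.1 == u.2.1 || t.2.2 == u.2.2)

/-- No three pairwise non-sharing edges. -/
def noTri (T : List (Bool × ℕ × ℕ)) : Bool :=
  T.all fun t => T.all fun u => shareT t u || T.all fun v => shareT t v || shareT u v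

def tagL (x : Bool) (L : List (ℕ × ℕ)) : List (Bool × ℕ × ℕ) := L.map (fun e => (x, e))

def midOK (k : Cfg) (n : ℕ) : Bool := noTri (tagL true (gE.filter (midE k n.testBit)))

theorem mid_check : cfgs.all (fun k => (List.range 512).all fun n =>
    !midOK k n || decide (cntC k.c n.testBit ≤ k.th) ||
      decide (cntC k.c (fun i => !n.testBit i) ≤ k.th)) = true := by decide +kernel

def candA (k : Cfg) : List ℕ :=
  if k.g then [0, 1, 2, 3, 4, 8, 9, 11, 16, 32, 64, 128, 256, 257, 288, 384, 416]
  else if k.n1 = 1 then [0, 1, 2, 3, 6, 7, 8, 9, 256, 257, 258, 259]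
  else if k.n1 = 3 then [0, 1, 2, 3, 8, 9, 72, 73, 256, 257, 264, 265]
  else if k.n1 = 5 then [0, 1, 32, 33, 36, 128, 256, 257, 288, 289, 292, 384]
  else [0, 1, 32, 128, 129, 192, 256, 257, 288, 384, 385, 448]

def candB (k : Cfg) : List ℕ := candA ⟨k.g, k.c, k.n2, k.n1, k.th⟩

theorem cand_check : cfgs.all (fun k => (List.range 512).all fun n =>
    !decide (cntC k.c n.testBit ≤ k.th) ||
      ((!midOK k n || (candA k).contains n) &&
       (!noTri (tagL true (gE.filter (midE k (fun i => !n.testBit i)))) ||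
        (candB k).contains n))) = true := by decide +kernel

def crossE (f : ℕ → Bool) (e : ℕ × ℕ) : Bool := f e.1 != f e.2

def tagged (a x y : ℕ → Bool) (p1 p2 : List (ℕ × ℕ)) : List (Bool × ℕ × ℕ) :=
  tagL true (gE.filter fun e => crossE a e && (touch x e || p1.contains e)) ++
  tagL false (gE.filter fun e => crossE a e && (touch y e || p2.contains e))

def tenFin (a b x y : ℕ → Bool) (U : List (ℕ × ℕ)) : Bool :=
  U.sublists.all fun p1 =>
    !noTri (tagged a x y p1 (U.filter fun e => !p1.contains e)) ||
    !noTri (tagged b x y p1 (U.filter fun e => !p1.contains e)) ||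
    cfgs.any (fun k => badC k a x b (fun e => touch x e || p1.contains e)) ||
    cfgs.any (fun k => badC k a y b (fun e => touch y e ||
      (U.filter fun e => !p1.contains e).contains e))

def adjB (i j : ℕ) : Bool := gE.any (isE i j)

/-- Enumerate all ways of splitting a list of vertices into two non-adjacent parts. -/
def goX (fin : List ℕ → List ℕ → Bool) : List ℕ → List ℕ → List ℕ → Bool
  | [], xs, ys => fin xs ys
  | i :: l, xs, ys =>
    (ys.any (adjB i) || goX fin l (i :: xs) ys) && (xs.any (adjB i) || goX fin l xs (i :: ys))

/-- The rest: vertices outside `a`, `b` (and not the corner). -/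
def rest (k : Cfg) (a b : ℕ → Bool) : List ℕ :=
  [0,1,2,3,4,5,6,7,8].filter fun i => i != k.c && !a i && !b i

def tenX (k : Cfg) (a b : ℕ → Bool) (xs ys : List ℕ) : Bool :=
  tenFin a b xs.contains ys.contains (gE.filter fun e =>
    known k a (fun i => xs.contains i || ys.contains i) b e &&
      !touch (fun i => xs.contains i || ys.contains i) e)

theorem ten_check : cfgs.all (fun k => (candA k).all fun a => (candB k).all fun b =>
    (a &&& b != 0) || !(k.g || ((a.testBit k.n1 || a.testBit k.c) &&
      (b.testBit k.n2 || b.testBit k.c))) ||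
      goX (tenX k a.testBit b.testBit) (rest k a.testBit b.testBit) [] []) = true := by
  decide +kernel


/-! ### Nets in a context -/

abbrev Ct := Set ℕ × Set ℕ

theorem img_sum {α β : Type} (π : α ⊕ β → ℕ) (s : Set α) (t : Set β) :
    π '' (Sum.inl '' s ∪ Sum.inr '' t) =
      (fun p => π (Sum.inl p)) '' s ∪ (fun p => π (Sum.inr p)) '' t := by
  simp only [Set.image_union, Set.image_image]

def ext {n : ℕ} (F : Fin n → Set Ct) (s : Set (Fin n)) : Set Ct :=
  {c | (s = ∅ ∧ c = ⊥) ∨ ∃ i, s = {i} ∧ c ∈ F i}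

def tc {l r : ℕ} (N : NetB l r) (π : N.P → ℕ) (x : N.T) : Ct := (π '' N.pre x, π '' N.post x)

def Full {l r : ℕ} (N : NetB l r) (π : N.P → ℕ) (cA : Fin l → Set Ct) (cB : Fin r → Set Ct) :
    Set Ct :=
  {c | ∃ x, ∃ a ∈ ext cA (N.src x), ∃ b ∈ ext cB (N.tgt x), c = a ⊔ tc N π x ⊔ b}

def ec (e : ℕ × ℕ) : Ct := ({e.1}, {e.2})

structure Sit {l r : ℕ} (N : NetB l r) (π : N.P → ℕ) (cA : Fin l → Set Ct)
    (cB : Fin r → Set Ct) (A S B : Set ℕ) : Prop where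
  inj : Function.Injective π
  rng : Set.range π = S
  dAS : Disjoint A S
  dAB : Disjoint A B
  dSB : Disjoint S B
  hA : ∀ i, ∀ c ∈ cA i, c ≤ (A, A)
  hB : ∀ i, ∀ c ∈ cB i, c ≤ (B, B)
  full : ∀ c ∈ Full N π cA cB, ∃ e ∈ gE, c = ec e
  touch : ∀ e ∈ gE, (e.1 ∈ S ∨ e.2 ∈ S) → ec e ∈ Full N π cA cB

theorem ext_le {n : ℕ} {F : Fin n → Set Ct} {A : Set ℕ} (h : ∀ i, ∀ c ∈ F i, c ≤ (A, A))
    {s : Set (Fin n)} {c : Ct} (hc : c ∈ ext F s) : c ≤ (A, A) := by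
  rcases hc with ⟨_, rfl⟩ | ⟨i, _, hc⟩
  · exact bot_le
  · exact h i c hc

theorem tc_le {l r : ℕ} (N : NetB l r) (π : N.P → ℕ) (x : N.T) :
    tc N π x ≤ (Set.range π, Set.range π) :=
  ⟨Set.image_subset_range _ _, Set.image_subset_range _ _⟩

theorem ec_inj {e f : ℕ × ℕ} (h : ec e = ec f) : e = f := by
  simp only [ec, Prod.mk.injEq, Set.singleton_eq_singleton_iff] at h
  exact Prod.ext h.1 h.2

theorem ec_le {e : ℕ × ℕ} {A : Set ℕ} : ec e ≤ (A, A) ↔ e.1 ∈ A ∧ e.2 ∈ A := by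
  simp [ec, Prod.le_def]

/-- One endpoint inside, the other one outside. -/
def Crs (A : Set ℕ) (e : ℕ × ℕ) : Prop := ¬ (e.1 ∈ A ↔ e.2 ∈ A)

theorem no_k22 : ∀ e ∈ gE, ∀ f ∈ gE, (e.1, f.2) ∈ gE → (f.1, e.2) ∈ gE →
    e.1 = f.1 ∨ e.2 = f.2 := by decide

/-- Splitting a crossing edge into its inner and outer part. -/
theorem split_edge {B D : Set ℕ} (hd : Disjoint D B) {y b : Ct} (hy : y ≤ (D, D))
    (hb : b ≤ (B, B)) {e : ℕ × ℕ} (h : y ⊔ b = ec e) (hc : Crs B e) :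
    (y = ({e.1}, ∅) ∧ b = (∅, {e.2})) ∨ (y = (∅, {e.2}) ∧ b = ({e.1}, ∅)) := by
  obtain ⟨y1, y2⟩ := y
  obtain ⟨b1, b2⟩ := b
  obtain ⟨p, q⟩ := e
  obtain ⟨hy1, hy2⟩ := hy
  obtain ⟨hb1, hb2⟩ := hb
  simp only [ec, Prod.mk_sup_mk, Prod.mk.injEq, Set.sup_eq_union] at h
  obtain ⟨h1, h2⟩ := h
  simp only [Set.le_eq_subset] at hy1 hy2 hb1 hb2
  rw [Set.disjoint_left] at hd
  have key : ∀ (u v : Set ℕ) (z : ℕ), u ⊆ D → v ⊆ B → u ∪ v = {z} →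
      (z ∈ B → u = ∅ ∧ v = {z}) ∧ (z ∉ B → u = {z} ∧ v = ∅) := by
    intro u v z hu hv huv
    have hu' : ∀ w ∈ u, w = z := fun w hw => by
      have : w ∈ u ∪ v := Or.inl hw
      rw [huv] at this; exact this
    have hv' : ∀ w ∈ v, w = z := fun w hw => by
      have : w ∈ u ∪ v := Or.inr hw
      rw [huv] at this; exact this
    constructor
    · intro hz
      have : u = ∅ := by
        ext w; constructor
        · intro hw; have := hu' w hw; subst this; exact (hd (hu hw) hz).elim
        · intro hw; exact hw.elim
      subst this
      simpa using huv
    · intro hz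
      have : v = ∅ := by
        ext w; constructor
        · intro hw; have := hv' w hw; subst this; exact (hz (hv hw)).elim
        · intro hw; exact hw.elim
      subst this
      simpa using huv
  have k1 := key _ _ _ hy1 hb1 h1
  have k2 := key _ _ _ hy2 hb2 h2
  simp only [Crs] at hc
  by_cases hp : p ∈ B
  · have hq : q ∉ B := fun hq => hc ⟨fun _ => hq, fun _ => hp⟩
    right
    simp [(k1.1 hp).1, (k1.1 hp).2, (k2.2 hq).1, (k2.2 hq).2]
  · have hq : q ∈ B := by
      by_contra hq
      exact hc ⟨fun h => (hp h).elim, fun h => (hq h).elim⟩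
    left
    simp [(k1.2 hp).1, (k1.2 hp).2, (k2.1 hq).1, (k2.1 hq).2]

theorem star {B D : Set ℕ} (hd : Disjoint D B) {y b y' b' : Ct} (hy : y ≤ (D, D))
    (hb : b ≤ (B, B)) (hy' : y' ≤ (D, D)) (hb' : b' ≤ (B, B)) {e f : ℕ × ℕ}
    (he : y ⊔ b = ec e) (hf : y' ⊔ b' = ec f) (hce : Crs B e) (hcf : Crs B f)
    (hE : e ∈ gE) (hF : f ∈ gE)
    (h1 : ∃ g ∈ gE, y ⊔ b' = ec g) (h2 : ∃ g ∈ gE, y' ⊔ b = ec g) :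
    e.1 = f.1 ∨ e.2 = f.2 := by
  obtain ⟨g1, hg1, h1⟩ := h1
  obtain ⟨g2, hg2, h2⟩ := h2
  rcases split_edge hd hy hb he hce with ⟨rfl, rfl⟩ | ⟨rfl, rfl⟩ <;>
  rcases split_edge hd hy' hb' hf hcf with ⟨rfl, rfl⟩ | ⟨rfl, rfl⟩
  · have e1 : g1 = (e.1, f.2) := ec_inj (by rw [← h1]; simp [ec])
    have e2 : g2 = (f.1, e.2) := ec_inj (by rw [← h2]; simp [ec])
    subst e1 e2
    exact no_k22 e hE f hF hg1 hg2
  · exfalso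
    simp only [ec, Prod.mk_sup_mk, Prod.mk.injEq, Set.sup_eq_union, Set.union_empty] at h1
    exact (Set.singleton_ne_empty _ h1.2.symm)
  · exfalso
    simp only [ec, Prod.mk_sup_mk, Prod.mk.injEq, Set.sup_eq_union, Set.union_empty] at h1
    exact (Set.singleton_ne_empty _ h1.1.symm)
  · have e1 : g1 = (f.1, e.2) := ec_inj (by rw [← h1]; simp [ec])
    have e2 : g2 = (e.1, f.2) := ec_inj (by rw [← h2]; simp [ec])
    subst e1 e2
    exact no_k22 e hE f hF hg2 hg1

/-- The edges of `R` crossing `B` are covered by `n` stars. -/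
def Cov (n : ℕ) (R : Set (ℕ × ℕ)) (B : Set ℕ) : Prop :=
  ∃ f : ℕ × ℕ → ℕ, ∀ e ∈ R, Crs B e → f e < n ∧
    ∀ e' ∈ R, Crs B e' → f e = f e' → e.1 = e'.1 ∨ e.2 = e'.2

/-- Realised edges. -/
def Rz {l r : ℕ} (N : NetB l r) (π : N.P → ℕ) (cA : Fin l → Set Ct) (cB : Fin r → Set Ct) :
    Set (ℕ × ℕ) := {e | e ∈ gE ∧ ec e ∈ Full N π cA cB}

theorem cov_of_fam {n : ℕ} {R : Set (ℕ × ℕ)} {B : Set ℕ} (G : Fin n → Set (ℕ × ℕ))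
    (h1 : ∀ e ∈ R, Crs B e → ∃ i, e ∈ G i)
    (h2 : ∀ i, ∀ e ∈ R, ∀ e' ∈ R, e ∈ G i → e' ∈ G i → Crs B e → Crs B e' →
      e.1 = e'.1 ∨ e.2 = e'.2) : Cov n R B := by
  classical
  refine ⟨fun e => if h : ∃ i, e ∈ G i then (h.choose : ℕ) else 0, ?_⟩
  intro e he hc
  have hx := h1 e he hc
  simp only [dif_pos hx]
  refine ⟨Fin.isLt _, ?_⟩
  intro e' he' hc' heq
  have hx' := h1 e' he' hc'
  simp only [dif_pos hx'] at heq
  have hh := Fin.ext heq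
  exact h2 hx.choose e he e' he' hx.choose_spec (hh ▸ hx'.choose_spec) hc hc'

theorem Sit.covR {l r : ℕ} {N : NetB l r} {π cA cB A S B} (h : Sit N π cA cB A S B) :
    Cov r (Rz N π cA cB) B := by
  have hd : Disjoint (A ∪ S) B := Set.disjoint_union_left.2 ⟨h.dAB, h.dSB⟩
  have hle : ∀ x, ∀ a ∈ ext cA (N.src x), a ⊔ tc N π x ≤ (A ∪ S, A ∪ S) := by
    intro x a ha
    refine sup_le ((ext_le h.hA ha).trans ⟨Set.subset_union_left, Set.subset_union_left⟩) ?_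
    refine (tc_le N π x).trans ?_
    rw [h.rng]
    exact ⟨Set.subset_union_right, Set.subset_union_right⟩
  apply cov_of_fam (fun j => {e | ∃ x, N.tgt x = {j} ∧ ∃ a ∈ ext cA (N.src x), ∃ b ∈ cB j,
      a ⊔ tc N π x ⊔ b = ec e})
  · rintro e ⟨-, x, a, ha, b, hb, hE⟩ hc
    rcases hb with ⟨_, rfl⟩ | ⟨j, hj, hb⟩
    · exfalso
      rw [sup_bot_eq] at hE
      have := hle x a ha
      rw [← hE, ec_le] at this
      rw [Set.disjoint_left] at hd
      exact hc ⟨fun h' => (hd this.1 h').elim, fun h' => (hd this.2 h').elim⟩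
    · exact ⟨j, x, hj, a, ha, b, hb, hE.symm⟩
  · rintro j e ⟨he, -⟩ e' ⟨he', -⟩ ⟨x, hx, a, ha, b, hb, hE⟩ ⟨x', hx', a', ha', b', hb', hE'⟩ hc hc'
    refine star hd (hle x a ha) (h.hB j b hb) (hle x' a' ha') (h.hB j b' hb') hE hE' hc hc'
      he he' ?_ ?_
    · exact h.full _ ⟨x, a, ha, b', Or.inr ⟨j, hx, hb'⟩, rfl⟩
    · exact h.full _ ⟨x', a', ha', b, Or.inr ⟨j, hx', hb⟩, rfl⟩

theorem Sit.covL {l r : ℕ} {N : NetB l r} {π cA cB A S B} (h : Sit N π cA cB A S B) :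
    Cov l (Rz N π cA cB) A := by
  have hd : Disjoint (S ∪ B) A := Set.disjoint_union_left.2 ⟨h.dAS.symm, h.dAB.symm⟩
  have hle : ∀ x, ∀ b ∈ ext cB (N.tgt x), tc N π x ⊔ b ≤ (S ∪ B, S ∪ B) := by
    intro x b hb
    refine sup_le ?_ ((ext_le h.hB hb).trans ⟨Set.subset_union_right, Set.subset_union_right⟩)
    refine (tc_le N π x).trans ?_
    rw [h.rng]
    exact ⟨Set.subset_union_left, Set.subset_union_left⟩
  apply cov_of_fam (fun j => {e | ∃ x, N.src x = {j} ∧ ∃ b ∈ ext cB (N.tgt x), ∃ a ∈ cA j,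
      tc N π x ⊔ b ⊔ a = ec e})
  · rintro e ⟨-, x, a, ha, b, hb, hE⟩ hc
    rcases ha with ⟨_, rfl⟩ | ⟨j, hj, ha⟩
    · exfalso
      rw [bot_sup_eq] at hE
      have := hle x b hb
      rw [← hE, ec_le] at this
      rw [Set.disjoint_left] at hd
      exact hc ⟨fun h' => (hd this.1 h').elim, fun h' => (hd this.2 h').elim⟩
    · exact ⟨j, x, hj, b, hb, a, ha, by rw [hE, sup_comm, sup_assoc]⟩
  · rintro j e ⟨he, -⟩ e' ⟨he', -⟩ ⟨x, hx, b, hb, a, ha, hE⟩ ⟨x', hx', b', hb', a', ha', hE'⟩ hc hc'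
    refine star hd (hle x b hb) (h.hA j a ha) (hle x' b' hb') (h.hA j a' ha') hE hE' hc hc'
      he he' ?_ ?_
    · exact h.full _ ⟨x, a', Or.inr ⟨j, hx, ha'⟩, b, hb, by rw [sup_comm, sup_assoc]⟩
    · exact h.full _ ⟨x', a, Or.inr ⟨j, hx', ha⟩, b', hb', by rw [sup_comm, sup_assoc]⟩

theorem Sit.rz_sub {l r : ℕ} {N : NetB l r} {π cA cB A S B} (h : Sit N π cA cB A S B)
    {e : ℕ × ℕ} (he : e ∈ Rz N π cA cB) : e.1 ∈ A ∪ S ∪ B ∧ e.2 ∈ A ∪ S ∪ B := by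
  obtain ⟨-, x, a, ha, b, hb, hE⟩ := he
  rw [← ec_le, hE]
  refine sup_le (sup_le ?_ ?_) ?_
  · exact (ext_le h.hA ha).trans
      ⟨fun _ h => Or.inl (Or.inl h), fun _ h => Or.inl (Or.inl h)⟩
  · refine (tc_le N π x).trans ?_
    rw [h.rng]
    exact ⟨fun _ h => Or.inl (Or.inr h), fun _ h => Or.inl (Or.inr h)⟩
  · exact (ext_le h.hB hb).trans ⟨fun _ h => Or.inr h, fun _ h => Or.inr h⟩

/-! ### Pure composition -/

def AtMost1 {n : ℕ} (s : Set (Fin n)) : Prop := s = ∅ ∨ ∃ j, s = {j}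

theorem atMost1_of {n : ℕ} {s : Set (Fin n)} (h : ∀ i ∈ s, ∀ j ∈ s, i = j) : AtMost1 s := by
  rcases s.eq_empty_or_nonempty with h0 | ⟨j, hj⟩
  · exact Or.inl h0
  · exact Or.inr ⟨j, Set.eq_singleton_iff_unique_mem.2 ⟨hj, fun i hi => h i hi j hj⟩⟩

theorem pure_left {k n l : ℕ} {X : NetB k n} {Y : NetB n l} (h : Pure X Y) (u : X.T) :
    AtMost1 (X.tgt u) := by
  apply atMost1_of
  intro i hi j hj
  by_contra hne
  have hi' : (bRight i : Port X) ∈ tports X u := Or.inr ⟨i, hi, rfl⟩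
  have hj' : (bRight j : Port X) ∈ tports X u := Or.inr ⟨j, hj, rfl⟩
  have hn : (bRight i : Port X) ≠ bRight j := by
    intro h'
    exact hne (Sum.inr.inj (Sum.inr.inj h'))
  refine h.1 j (tports X u \ {bRight j}) ⟨u, ?_, rfl⟩ i ⟨hi', hn⟩
  rw [Set.ssubset_iff_subset_ne]
  refine ⟨Set.singleton_subset_iff.2 hj', fun he => hn ?_⟩
  rw [← he] at hi'
  exact hi'

theorem pure_right {k n l : ℕ} {X : NetB k n} {Y : NetB n l} (h : Pure X Y) (u : Y.T) :
    AtMost1 (Y.src u) := by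
  apply atMost1_of
  intro i hi j hj
  by_contra hne
  have hi' : (bLeft i : Port Y) ∈ tports Y u := Or.inl (Or.inr ⟨i, hi, rfl⟩)
  have hj' : (bLeft j : Port Y) ∈ tports Y u := Or.inl (Or.inr ⟨j, hj, rfl⟩)
  have hn : (bLeft i : Port Y) ≠ bLeft j := by
    intro h'
    exact hne (Sum.inl.inj (Sum.inr.inj h'))
  refine h.2 j (tports Y u \ {bLeft j}) ⟨u, ?_, rfl⟩ i ⟨hi', hn⟩
  rw [Set.ssubset_iff_subset_ne]
  refine ⟨Set.singleton_subset_iff.2 hj', fun he => hn ?_⟩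
  rw [← he] at hi'
  exact hi'

theorem mi_single {k l : ℕ} (N : NetB k l) (u : N.T) : MI N {u} := by
  rintro a rfl b rfl _
  rfl

theorem mi_empty {k l : ℕ} (N : NetB k l) : MI N ∅ := by
  rintro a ha
  exact ha.elim

section
variable {k n l : ℕ} {X : NetB k n} {Y : NetB n l}

theorem sync_left (u : X.T) (h : X.tgt u = ∅) :
    ∃ s : (comp X Y).T, s.1.U = {u} ∧ s.1.V = ∅ := by
  refine ⟨⟨⟨{u}, ∅, mi_single X u, mi_empty Y, by simp [setTgt, setSrc, h]⟩, ?_, ?_⟩, rfl, rfl⟩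
  · rintro ⟨h1, -⟩
    exact Set.singleton_ne_empty _ h1
  · intro s' h1 h2
    have h2 := Set.subset_empty_iff.1 h2
    rcases Set.subset_singleton_iff_eq.1 h1 with h1 | h1
    · exact Or.inl ⟨h1, h2⟩
    · exact Or.inr ⟨h1, h2⟩

theorem sync_right (v : Y.T) (h : Y.src v = ∅) :
    ∃ s : (comp X Y).T, s.1.U = ∅ ∧ s.1.V = {v} := by
  refine ⟨⟨⟨∅, {v}, mi_empty X, mi_single Y v, by simp [setTgt, setSrc, h]⟩, ?_, ?_⟩, rfl, rfl⟩
  · rintro ⟨-, h1⟩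
    exact Set.singleton_ne_empty _ h1
  · intro s' h2 h1
    have h2 := Set.subset_empty_iff.1 h2
    rcases Set.subset_singleton_iff_eq.1 h1 with h1 | h1
    · exact Or.inl ⟨h2, h1⟩
    · exact Or.inr ⟨h2, h1⟩

theorem sync_pair (u : X.T) (v : Y.T) (j : Fin n) (hu : X.tgt u = {j}) (hv : Y.src v = {j}) :
    ∃ s : (comp X Y).T, s.1.U = {u} ∧ s.1.V = {v} := by
  refine ⟨⟨⟨{u}, {v}, mi_single X u, mi_single Y v, by simp [setTgt, setSrc, hu, hv]⟩, ?_, ?_⟩,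
    rfl, rfl⟩
  · rintro ⟨-, h1⟩
    exact Set.singleton_ne_empty _ h1
  · intro s' h1 h2
    have hb := s'.bd
    rcases Set.subset_singleton_iff_eq.1 h1 with h1 | h1 <;>
    rcases Set.subset_singleton_iff_eq.1 h2 with h2 | h2
    · exact Or.inl ⟨h1, h2⟩
    · exfalso
      rw [h1, h2] at hb
      simp only [setTgt, setSrc, Set.mem_empty_iff_false, Set.iUnion_of_empty, Set.iUnion_empty,
        Set.mem_singleton_iff, Set.iUnion_iUnion_eq_left, hv] at hb
      exact Set.singleton_ne_empty _ hb.symm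
    · exfalso
      rw [h1, h2] at hb
      simp only [setTgt, setSrc, Set.mem_empty_iff_false, Set.iUnion_of_empty, Set.iUnion_empty,
        Set.mem_singleton_iff, Set.iUnion_iUnion_eq_left, hu] at hb
      exact Set.singleton_ne_empty _ hb
    · exact Or.inr ⟨h1, h2⟩

theorem sync_class (hp : Pure X Y) (s : (comp X Y).T) :
    (∃ u, X.tgt u = ∅ ∧ s.1.U = {u} ∧ s.1.V = ∅) ∨
    (∃ v, Y.src v = ∅ ∧ s.1.U = ∅ ∧ s.1.V = {v}) ∨
    (∃ u v j, X.tgt u = {j} ∧ Y.src v = {j} ∧ s.1.U = {u} ∧ s.1.V = {v}) := by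
  obtain ⟨s, hnt, hmin⟩ := s
  have cmp : ∀ s' : (comp X Y).T, s'.1.U ⊆ s.U → s'.1.V ⊆ s.V →
      s.U = s'.1.U ∧ s.V = s'.1.V := by
    intro s' h1 h2
    rcases hmin s'.1 h1 h2 with h | h
    · exact (s'.2.1 h).elim
    · exact ⟨h.1.symm, h.2.symm⟩
  show (∃ u, X.tgt u = ∅ ∧ s.U = {u} ∧ s.V = ∅) ∨
    (∃ v, Y.src v = ∅ ∧ s.U = ∅ ∧ s.V = {v}) ∨
    (∃ u v j, X.tgt u = {j} ∧ Y.src v = {j} ∧ s.U = {u} ∧ s.V = {v})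
  by_cases h1 : ∃ u ∈ s.U, X.tgt u = ∅
  · obtain ⟨u, hu, hE⟩ := h1
    obtain ⟨s', a, b⟩ := sync_left (Y := Y) u hE
    obtain ⟨c, d⟩ := cmp s' (by simpa [a] using hu) (by simp [b])
    exact Or.inl ⟨u, hE, c.trans a, d.trans b⟩
  by_cases h2 : ∃ v ∈ s.V, Y.src v = ∅
  · obtain ⟨u, hu, hE⟩ := h2
    obtain ⟨s', a, b⟩ := sync_right (X := X) u hE
    obtain ⟨c, d⟩ := cmp s' (by simp [a]) (by simpa [b] using hu)
    exact Or.inr (Or.inl ⟨u, hE, c.trans a, d.trans b⟩)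
  have hbd := s.bd
  rcases s.U.eq_empty_or_nonempty with hU | ⟨u, hu⟩
  · rcases s.V.eq_empty_or_nonempty with hV | ⟨v, hv⟩
    · exact (hnt ⟨hU, hV⟩).elim
    · exfalso
      rw [hU] at hbd
      rcases pure_right hp v with h | ⟨j, hj⟩
      · exact h2 ⟨v, hv, h⟩
      · have : j ∈ setSrc Y s.V := by
          simp only [setSrc, Set.mem_iUnion]
          exact ⟨v, hv, by simp [hj]⟩
        rw [← hbd] at this
        simp [setTgt] at this
  · rcases pure_left hp u with h | ⟨j, hj⟩
    · exact (h1 ⟨u, hu, h⟩).elim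
    · have : j ∈ setTgt X s.U := by
        simp only [setTgt, Set.mem_iUnion]
        exact ⟨u, hu, by simp [hj]⟩
      rw [hbd] at this
      simp only [setSrc, Set.mem_iUnion] at this
      obtain ⟨v, hv, hjv⟩ := this
      rcases pure_right hp v with h | ⟨j', hj'⟩
      · exact (h2 ⟨v, hv, h⟩).elim
      · have : j = j' := by rw [hj'] at hjv; exact hjv
        subst this
        obtain ⟨s', a, b⟩ := sync_pair u v j hj hj'
        obtain ⟨c, d⟩ := cmp s' (by simpa [a] using hu) (by simpa [b] using hv)
        exact Or.inr (Or.inr ⟨u, v, j, hj, hj', c.trans a, d.trans b⟩)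

variable (X Y) in
def mB (πY : Y.P → ℕ) (cB : Fin l → Set Ct) (j : Fin n) : Set Ct :=
  {c | ∃ v, Y.src v = {j} ∧ ∃ b ∈ ext cB (Y.tgt v), c = tc Y πY v ⊔ b}

variable (X Y) in
def mA (πX : X.P → ℕ) (cA : Fin k → Set Ct) (j : Fin n) : Set Ct :=
  {c | ∃ u, X.tgt u = {j} ∧ ∃ a ∈ ext cA (X.src u), c = a ⊔ tc X πX u}

variable (X Y) in
def F1 (πX : X.P → ℕ) (cA : Fin k → Set Ct) : Set Ct :=
  {c | ∃ u, X.tgt u = ∅ ∧ ∃ a ∈ ext cA (X.src u), c = a ⊔ tc X πX u}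

variable (X Y) in
def F2 (πY : Y.P → ℕ) (cB : Fin l → Set Ct) : Set Ct :=
  {c | ∃ v, Y.src v = ∅ ∧ ∃ b ∈ ext cB (Y.tgt v), c = tc Y πY v ⊔ b}

variable (X Y) in
def F3 (πX : X.P → ℕ) (πY : Y.P → ℕ) (cA : Fin k → Set Ct) (cB : Fin l → Set Ct) : Set Ct :=
  {c | ∃ u v j, X.tgt u = {j} ∧ Y.src v = {j} ∧ ∃ a ∈ ext cA (X.src u),
    ∃ b ∈ ext cB (Y.tgt v), c = (a ⊔ tc X πX u) ⊔ (tc Y πY v ⊔ b)}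

theorem ext_empty {m : ℕ} {F : Fin m → Set Ct} {c : Ct} : c ∈ ext F ∅ ↔ c = ⊥ := by
  constructor
  · rintro (⟨_, h⟩ | ⟨i, h, _⟩)
    · exact h
    · exact (Set.singleton_ne_empty _ h.symm).elim
  · intro h; exact Or.inl ⟨rfl, h⟩

theorem ext_single {m : ℕ} {F : Fin m → Set Ct} {c : Ct} {j : Fin m} :
    c ∈ ext F {j} ↔ c ∈ F j := by
  constructor
  · rintro (⟨h, _⟩ | ⟨i, h, h'⟩)
    · exact (Set.singleton_ne_empty _ h).elim
    · rw [Set.singleton_eq_singleton_iff.1 h]; exact h'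
  · intro h; exact Or.inr ⟨j, rfl, h⟩

theorem fullX_eq (hp : Pure X Y) (πX : X.P → ℕ) (πY : Y.P → ℕ) (cA : Fin k → Set Ct)
    (cB : Fin l → Set Ct) :
    Full X πX cA (mB Y πY cB) = F1 X πX cA ∪ F3 X Y πX πY cA cB := by
  ext c
  constructor
  · rintro ⟨u, a, ha, b, hb, rfl⟩
    rcases pure_left hp u with h | ⟨j, hj⟩
    · rw [h, ext_empty] at hb
      subst hb
      exact Or.inl ⟨u, h, a, ha, by simp⟩
    · rw [hj, ext_single] at hb
      obtain ⟨v, hv, b, hb, rfl⟩ := hb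
      exact Or.inr ⟨u, v, j, hj, hv, a, ha, b, hb, rfl⟩
  · rintro (⟨u, h, a, ha, rfl⟩ | ⟨u, v, j, hj, hv, a, ha, b, hb, rfl⟩)
    · exact ⟨u, a, ha, ⊥, by rw [h, ext_empty], by simp⟩
    · exact ⟨u, a, ha, _, by rw [hj, ext_single]; exact ⟨v, hv, b, hb, rfl⟩, rfl⟩

theorem fullY_eq (hp : Pure X Y) (πX : X.P → ℕ) (πY : Y.P → ℕ) (cA : Fin k → Set Ct)
    (cB : Fin l → Set Ct) :
    Full Y πY (mA X πX cA) cB = F2 Y πY cB ∪ F3 X Y πX πY cA cB := by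
  ext c
  constructor
  · rintro ⟨v, a, ha, b, hb, rfl⟩
    rcases pure_right hp v with h | ⟨j, hj⟩
    · rw [h, ext_empty] at ha
      subst ha
      exact Or.inl ⟨v, h, b, hb, by simp⟩
    · rw [hj, ext_single] at ha
      obtain ⟨u, hu, a, ha, rfl⟩ := ha
      exact Or.inr ⟨u, v, j, hu, hj, a, ha, b, hb, by simp only [sup_assoc]⟩
  · rintro (⟨v, h, b, hb, rfl⟩ | ⟨u, v, j, hj, hv, a, ha, b, hb, rfl⟩)
    · exact ⟨v, ⊥, by rw [h, ext_empty], b, hb, by simp⟩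
    · exact ⟨v, _, by rw [hv, ext_single]; exact ⟨u, hj, a, ha, rfl⟩, b, hb,
        by simp only [sup_assoc]⟩

theorem tc_comp (π : (comp X Y).P → ℕ) (s : (comp X Y).T) :
    tc (comp X Y) π s = ((fun p => π (Sum.inl p)) '' setPre X s.1.U ∪
      (fun p => π (Sum.inr p)) '' setPre Y s.1.V,
      (fun p => π (Sum.inl p)) '' setPost X s.1.U ∪
      (fun p => π (Sum.inr p)) '' setPost Y s.1.V) := by
  exact Prod.ext (img_sum π _ _) (img_sum π _ _)

theorem fullN_eq (hp : Pure X Y) (π : (comp X Y).P → ℕ) (cA : Fin k → Set Ct)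
    (cB : Fin l → Set Ct) :
    Full (comp X Y) π cA cB = F1 X (fun p => π (Sum.inl p)) cA ∪ F2 Y (fun p => π (Sum.inr p)) cB ∪
      F3 X Y (fun p => π (Sum.inl p)) (fun p => π (Sum.inr p)) cA cB := by
  have t1 : ∀ (s : (comp X Y).T) u, s.1.U = {u} → s.1.V = ∅ →
      tc (comp X Y) π s = tc X (fun p => π (Sum.inl p)) u ∧ (comp X Y).src s = X.src u ∧
        (comp X Y).tgt s = ∅ := by
    intro s u h1 h2
    rw [tc_comp, h1, h2]
    refine ⟨by simp [setPre, setPost, tc], ?_, ?_⟩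
    · show setSrc X s.1.U = _
      rw [h1]; simp [setSrc]
    · show setTgt Y s.1.V = _
      rw [h2]; simp [setTgt]
  have t2 : ∀ (s : (comp X Y).T) v, s.1.U = ∅ → s.1.V = {v} →
      tc (comp X Y) π s = tc Y (fun p => π (Sum.inr p)) v ∧ (comp X Y).src s = ∅ ∧
        (comp X Y).tgt s = Y.tgt v := by
    intro s u h1 h2
    rw [tc_comp, h1, h2]
    refine ⟨by simp [setPre, setPost, tc], ?_, ?_⟩
    · show setSrc X s.1.U = _
      rw [h1]; simp [setSrc]
    · show setTgt Y s.1.V = _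
      rw [h2]; simp [setTgt]
  have t3 : ∀ (s : (comp X Y).T) u v, s.1.U = {u} → s.1.V = {v} →
      tc (comp X Y) π s = tc X (fun p => π (Sum.inl p)) u ⊔ tc Y (fun p => π (Sum.inr p)) v ∧
        (comp X Y).src s = X.src u ∧ (comp X Y).tgt s = Y.tgt v := by
    intro s u v h1 h2
    rw [tc_comp, h1, h2]
    refine ⟨by simp [setPre, setPost, tc], ?_, ?_⟩
    · show setSrc X s.1.U = _
      rw [h1]; simp [setSrc]
    · show setTgt Y s.1.V = _
      rw [h2]; simp [setTgt]
  ext c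
  constructor
  · rintro ⟨s, a, ha, b, hb, rfl⟩
    rcases sync_class hp s with ⟨u, h, h1, h2⟩ | ⟨v, h, h1, h2⟩ | ⟨u, v, j, hu, hv, h1, h2⟩
    · obtain ⟨e1, e2, e3⟩ := t1 s u h1 h2
      rw [e2] at ha
      rw [e3, ext_empty] at hb
      subst hb
      exact Or.inl (Or.inl ⟨u, h, a, ha, by rw [e1]; simp⟩)
    · obtain ⟨e1, e2, e3⟩ := t2 s v h1 h2
      rw [e3] at hb
      rw [e2, ext_empty] at ha
      subst ha
      exact Or.inl (Or.inr ⟨v, h, b, hb, by rw [e1]; simp⟩)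
    · obtain ⟨e1, e2, e3⟩ := t3 s u v h1 h2
      rw [e2] at ha
      rw [e3] at hb
      exact Or.inr ⟨u, v, j, hu, hv, a, ha, b, hb, by rw [e1]; simp only [sup_assoc]⟩
  · rintro ((⟨u, h, a, ha, rfl⟩ | ⟨v, h, b, hb, rfl⟩) | ⟨u, v, j, hu, hv, a, ha, b, hb, rfl⟩)
    · obtain ⟨s, h1, h2⟩ := sync_left (Y := Y) u h
      obtain ⟨e1, e2, e3⟩ := t1 s u h1 h2
      exact ⟨s, a, by rwa [e2], ⊥, by rw [e3, ext_empty], by rw [e1]; simp⟩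
    · obtain ⟨s, h1, h2⟩ := sync_right (X := X) v h
      obtain ⟨e1, e2, e3⟩ := t2 s v h1 h2
      exact ⟨s, ⊥, by rw [e2, ext_empty], b, by rwa [e3], by rw [e1]; simp⟩
    · obtain ⟨s, h1, h2⟩ := sync_pair u v j hu hv
      obtain ⟨e1, e2, e3⟩ := t3 s u v h1 h2
      exact ⟨s, a, by rwa [e2], b, by rwa [e3], by rw [e1]; simp only [sup_assoc]⟩

theorem sit_seq (hp : Pure X Y) {π : (comp X Y).P → ℕ} {cA : Fin k → Set Ct}
    {cB : Fin l → Set Ct} {A S B : Set ℕ} (h : Sit (comp X Y) π cA cB A S B) :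
    ∃ (πX : X.P → ℕ) (πY : Y.P → ℕ) (mb ma : Fin n → Set Ct) (SX SY : Set ℕ),
      Sit X πX cA mb A SX (SY ∪ B) ∧ Sit Y πY ma cB (A ∪ SX) SY B ∧ S = SX ∪ SY ∧
      (∀ e ∈ Rz (comp X Y) π cA cB, Crs (SY ∪ B) e →
        e ∈ Rz X πX cA mb ∧ e ∈ Rz Y πY ma cB) := by
  have hS : S = Set.range (fun p => π (Sum.inl p)) ∪ Set.range (fun p => π (Sum.inr p)) := by
    rw [← h.rng]
    ext z
    constructor
    · rintro ⟨p | p, rfl⟩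
      · exact Or.inl ⟨p, rfl⟩
      · exact Or.inr ⟨p, rfl⟩
    · rintro (⟨p, rfl⟩ | ⟨p, rfl⟩)
      · exact ⟨_, rfl⟩
      · exact ⟨_, rfl⟩
  obtain ⟨dA1, dA2⟩ := Set.disjoint_union_right.1 (hS ▸ h.dAS)
  obtain ⟨dB1, dB2⟩ := Set.disjoint_union_left.1 (hS ▸ h.dSB)
  have dXY : Disjoint (Set.range (fun p => π (Sum.inl p))) (Set.range (fun p => π (Sum.inr p))) := by
    rw [Set.disjoint_left]
    rintro _ ⟨p, rfl⟩ ⟨q, hq⟩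
    have := h.inj hq
    cases this
  have hN := fullN_eq hp π cA cB
  have hX := fullX_eq hp (fun p => π (Sum.inl p)) (fun p => π (Sum.inr p)) cA cB
  have hY := fullY_eq hp (fun p => π (Sum.inl p)) (fun p => π (Sum.inr p)) cA cB
  set πX : X.P → ℕ := fun p => π (Sum.inl p) with hπX
  set πY : Y.P → ℕ := fun p => π (Sum.inr p) with hπY
  set SX := Set.range πX with hSX
  set SY := Set.range πY with hSY
  have f1 : ∀ c ∈ F1 X πX cA, c ≤ (A ∪ SX, A ∪ SX) := by
    rintro c ⟨u, _, a, ha, rfl⟩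
    exact sup_le ((ext_le h.hA ha).trans ⟨Set.subset_union_left, Set.subset_union_left⟩)
      ((tc_le X πX u).trans ⟨Set.subset_union_right, Set.subset_union_right⟩)
  have f2 : ∀ c ∈ F2 Y πY cB, c ≤ (SY ∪ B, SY ∪ B) := by
    rintro c ⟨u, _, a, ha, rfl⟩
    exact sup_le ((tc_le Y πY u).trans ⟨Set.subset_union_left, Set.subset_union_left⟩)
      ((ext_le h.hB ha).trans ⟨Set.subset_union_right, Set.subset_union_right⟩)
  have dm : Disjoint (A ∪ SX) (SY ∪ B) := by
    simp only [Set.disjoint_union_left, Set.disjoint_union_right]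
    exact ⟨⟨dA2, dXY⟩, ⟨h.dAB, dB1⟩⟩
  rw [Set.disjoint_left] at dm
  refine ⟨πX, πY, mB Y πY cB, mA X πX cA, SX, SY, ?_, ?_, hS, ?_⟩
  · refine ⟨?_, rfl, dA1, ?_, ?_, h.hA, ?_, ?_, ?_⟩
    · intro p q hpq
      exact Sum.inl.inj (h.inj hpq)
    · exact Set.disjoint_union_right.2 ⟨dA2, h.dAB⟩
    · exact Set.disjoint_union_right.2 ⟨dXY, dB1⟩
    · rintro i c ⟨v, _, b, hb, rfl⟩
      exact sup_le ((tc_le Y πY v).trans ⟨Set.subset_union_left, Set.subset_union_left⟩)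
        ((ext_le h.hB hb).trans ⟨Set.subset_union_right, Set.subset_union_right⟩)
    · intro c hc
      apply h.full
      rw [hN]
      rw [hX] at hc
      rcases hc with hc | hc
      · exact Or.inl (Or.inl hc)
      · exact Or.inr hc
    · intro e he ht
      have := h.touch e he (by rw [hS]; exact ht.imp Or.inl Or.inl)
      rw [hN] at this
      rw [hX]
      rcases this with (h1 | h1) | h1
      · exact Or.inl h1
      · exfalso
        have := ec_le.1 (f2 _ h1)
        rcases ht with ht | ht
        · exact dm (Or.inr ht) this.1
        · exact dm (Or.inr ht) this.2
      · exact Or.inr h1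
  · refine ⟨?_, rfl, ?_, ?_, dB2, ?_, h.hB, ?_, ?_⟩
    · intro p q hpq
      exact Sum.inr.inj (h.inj hpq)
    · exact Set.disjoint_union_left.2 ⟨dA2, dXY⟩
    · exact Set.disjoint_union_left.2 ⟨h.dAB, dB1⟩
    · rintro i c ⟨u, _, a, ha, rfl⟩
      exact sup_le ((ext_le h.hA ha).trans ⟨Set.subset_union_left, Set.subset_union_left⟩)
        ((tc_le X πX u).trans ⟨Set.subset_union_right, Set.subset_union_right⟩)
    · intro c hc
      apply h.full
      rw [hN]
      rw [hY] at hc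
      rcases hc with hc | hc
      · exact Or.inl (Or.inr hc)
      · exact Or.inr hc
    · intro e he ht
      have := h.touch e he (by rw [hS]; exact ht.imp Or.inr Or.inr)
      rw [hN] at this
      rw [hY]
      rcases this with (h1 | h1) | h1
      · exfalso
        have := ec_le.1 (f1 _ h1)
        rcases ht with ht | ht
        · exact dm this.1 (Or.inl ht)
        · exact dm this.2 (Or.inl ht)
      · exact Or.inl h1
      · exact Or.inr h1
  · rintro e ⟨he, hf⟩ hc
    rw [hN] at hf
    rcases hf with (h1 | h1) | h1
    · exfalso
      have := ec_le.1 (f1 _ h1)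
      exact hc ⟨fun h' => (dm this.1 h').elim, fun h' => (dm this.2 h').elim⟩
    · exfalso
      have := ec_le.1 (f2 _ h1)
      exact hc ⟨fun _ => this.2, fun _ => this.1⟩
    · exact ⟨⟨he, hX ▸ Or.inr h1⟩, ⟨he, hY ▸ Or.inr h1⟩⟩

end

/-! ### Tensor -/

theorem ext_image {m n : ℕ} (F : Fin n → Set Ct) (g : Fin m → Fin n)
    (s : Set (Fin m)) (hg : Function.Injective g) :
    ext F (g '' s) = ext (fun i => F (g i)) s := by
  ext c
  simp only [ext, Set.mem_setOf_eq, Set.image_eq_empty]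
  refine or_congr Iff.rfl ⟨?_, ?_⟩
  · rintro ⟨i, hi, hc⟩
    have : i ∈ g '' s := by rw [hi]; rfl
    obtain ⟨j, hj, rfl⟩ := this
    refine ⟨j, ?_, hc⟩
    rw [← Set.image_singleton] at hi
    exact hg.image_injective hi
  · rintro ⟨i, rfl, hc⟩
    exact ⟨g i, by simp, hc⟩

theorem sit_ten {l m k n : ℕ} {X : NetB l m} {Y : NetB k n} {π : (tensor X Y).P → ℕ}
    {cA : Fin (l + k) → Set Ct} {cB : Fin (m + n) → Set Ct} {A S B : Set ℕ}
    (h : Sit (tensor X Y) π cA cB A S B) :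
    ∃ (πX : X.P → ℕ) (πY : Y.P → ℕ) (aX : Fin l → Set Ct) (aY : Fin k → Set Ct)
      (bX : Fin m → Set Ct) (bY : Fin n → Set Ct) (SX SY : Set ℕ),
      Sit X πX aX bX A SX B ∧ Sit Y πY aY bY A SY B ∧ S = SX ∪ SY ∧ Disjoint SX SY ∧
      (∀ e ∈ Rz (tensor X Y) π cA cB, e ∈ Rz X πX aX bX ∨ e ∈ Rz Y πY aY bY) := by
  have hS : S = Set.range (fun p => π (Sum.inl p)) ∪ Set.range (fun p => π (Sum.inr p)) := by
    rw [← h.rng]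
    ext z
    constructor
    · rintro ⟨p | p, rfl⟩
      · exact Or.inl ⟨p, rfl⟩
      · exact Or.inr ⟨p, rfl⟩
    · rintro (⟨p, rfl⟩ | ⟨p, rfl⟩)
      · exact ⟨_, rfl⟩
      · exact ⟨_, rfl⟩
  obtain ⟨dA1, dA2⟩ := Set.disjoint_union_right.1 (hS ▸ h.dAS)
  obtain ⟨dB1, dB2⟩ := Set.disjoint_union_left.1 (hS ▸ h.dSB)
  have dXY : Disjoint (Set.range (fun p => π (Sum.inl p))) (Set.range (fun p => π (Sum.inr p))) := by
    rw [Set.disjoint_left]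
    rintro _ ⟨p, rfl⟩ ⟨q, hq⟩
    have := h.inj hq
    cases this
  set πX : X.P → ℕ := fun p => π (Sum.inl p) with hπX
  set πY : Y.P → ℕ := fun p => π (Sum.inr p) with hπY
  set SX := Set.range πX with hSX
  set SY := Set.range πY with hSY
  let aX : Fin l → Set Ct := fun i => cA (Fin.castAdd k i)
  let aY : Fin k → Set Ct := fun i => cA (Fin.natAdd l i)
  let bX : Fin m → Set Ct := fun i => cB (Fin.castAdd n i)
  let bY : Fin n → Set Ct := fun i => cB (Fin.natAdd m i)
  have hN : Full (tensor X Y) π cA cB = Full X πX aX bX ∪ Full Y πY aY bY := by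
    have tl : ∀ u, tc (tensor X Y) π (Sum.inl u) = tc X πX u := by
      intro u; exact Prod.ext (Set.image_image _ _ _) (Set.image_image _ _ _)
    have tr : ∀ u, tc (tensor X Y) π (Sum.inr u) = tc Y πY u := by
      intro u; exact Prod.ext (Set.image_image _ _ _) (Set.image_image _ _ _)
    have sl : ∀ u, ext cA ((tensor X Y).src (Sum.inl u)) = ext aX (X.src u) :=
      fun u => ext_image cA _ _ (Fin.castAdd_injective l k)
    have sr : ∀ u, ext cA ((tensor X Y).src (Sum.inr u)) = ext aY (Y.src u) :=
      fun u => ext_image cA _ _ (Fin.natAdd_injective k l)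
    have gl : ∀ u, ext cB ((tensor X Y).tgt (Sum.inl u)) = ext bX (X.tgt u) :=
      fun u => ext_image cB _ _ (Fin.castAdd_injective m n)
    have gr : ∀ u, ext cB ((tensor X Y).tgt (Sum.inr u)) = ext bY (Y.tgt u) :=
      fun u => ext_image cB _ _ (Fin.natAdd_injective n m)
    ext c
    constructor
    · rintro ⟨u | u, a, ha, b, hb, rfl⟩
      · exact Or.inl ⟨u, a, sl u ▸ ha, b, gl u ▸ hb, by rw [tl]⟩
      · exact Or.inr ⟨u, a, sr u ▸ ha, b, gr u ▸ hb, by rw [tr]⟩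
    · rintro (⟨u, a, ha, b, hb, rfl⟩ | ⟨u, a, ha, b, hb, rfl⟩)
      · exact ⟨Sum.inl u, a, (sl u).symm ▸ ha, b, (gl u).symm ▸ hb, by rw [tl]⟩
      · exact ⟨Sum.inr u, a, (sr u).symm ▸ ha, b, (gr u).symm ▸ hb, by rw [tr]⟩
  have leX : ∀ c ∈ Full X πX aX bX, c ≤ (A ∪ SX ∪ B, A ∪ SX ∪ B) := by
    rintro c ⟨u, a, ha, b, hb, rfl⟩
    refine sup_le (sup_le ?_ ?_) ?_
    · exact (ext_le (fun i => h.hA _) ha).trans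
        ⟨fun _ h => Or.inl (Or.inl h), fun _ h => Or.inl (Or.inl h)⟩
    · exact (tc_le X πX u).trans
        ⟨fun _ h => Or.inl (Or.inr h), fun _ h => Or.inl (Or.inr h)⟩
    · exact (ext_le (fun i => h.hB _) hb).trans ⟨fun _ h => Or.inr h, fun _ h => Or.inr h⟩
  have leY : ∀ c ∈ Full Y πY aY bY, c ≤ (A ∪ SY ∪ B, A ∪ SY ∪ B) := by
    rintro c ⟨u, a, ha, b, hb, rfl⟩
    refine sup_le (sup_le ?_ ?_) ?_
    · exact (ext_le (fun i => h.hA _) ha).trans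
        ⟨fun _ h => Or.inl (Or.inl h), fun _ h => Or.inl (Or.inl h)⟩
    · exact (tc_le Y πY u).trans
        ⟨fun _ h => Or.inl (Or.inr h), fun _ h => Or.inl (Or.inr h)⟩
    · exact (ext_le (fun i => h.hB _) hb).trans ⟨fun _ h => Or.inr h, fun _ h => Or.inr h⟩
  have dX : Disjoint SX (A ∪ SY ∪ B) := by
    simp only [Set.disjoint_union_right]
    exact ⟨⟨dA1.symm, dXY⟩, dB1⟩
  have dY : Disjoint SY (A ∪ SX ∪ B) := by
    simp only [Set.disjoint_union_right]
    exact ⟨⟨dA2.symm, dXY.symm⟩, dB2⟩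
  rw [Set.disjoint_left] at dX dY
  refine ⟨πX, πY, aX, aY, bX, bY, SX, SY, ?_, ?_, hS, dXY, ?_⟩
  · refine ⟨?_, rfl, dA1, h.dAB, dB1, fun i => h.hA _, fun i => h.hB _, ?_, ?_⟩
    · intro p q hpq
      exact Sum.inl.inj (h.inj hpq)
    · intro c hc
      exact h.full c (hN ▸ Or.inl hc)
    · intro e he ht
      have := h.touch e he (by rw [hS]; exact ht.imp Or.inl Or.inl)
      rw [hN] at this
      rcases this with h1 | h1
      · exact h1
      · exfalso
        have := ec_le.1 (leY _ h1)
        rcases ht with ht | ht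
        · exact dX ht this.1
        · exact dX ht this.2
  · refine ⟨?_, rfl, dA2, h.dAB, dB2, fun i => h.hA _, fun i => h.hB _, ?_, ?_⟩
    · intro p q hpq
      exact Sum.inr.inj (h.inj hpq)
    · intro c hc
      exact h.full c (hN ▸ Or.inr hc)
    · intro e he ht
      have := h.touch e he (by rw [hS]; exact ht.imp Or.inr Or.inr)
      rw [hN] at this
      rcases this with h1 | h1
      · exfalso
        have := ec_le.1 (leX _ h1)
        rcases ht with ht | ht
        · exact dY ht this.1
        · exact dY ht this.2
      · exact h1
  · rintro e ⟨he, hf⟩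
    rw [hN] at hf
    exact hf.imp (fun h => ⟨he, h⟩) (fun h => ⟨he, h⟩)



/-! ### Bridging sets and Boolean functions -/

open Classical in
noncomputable def chi (A : Set ℕ) : ℕ → Bool := fun i => decide (i ∈ A)

theorem chi_iff {A : Set ℕ} {i : ℕ} : chi A i = true ↔ i ∈ A := by simp [chi]

theorem chi_false {A : Set ℕ} {i : ℕ} : chi A i = false ↔ i ∉ A := by simp [chi]

theorem chi_eq {A : Set ℕ} {f : ℕ → Bool} (h : ∀ i, f i = true ↔ i ∈ A) : f = chi A := by
  funext i
  rw [Bool.eq_iff_iff, h, chi_iff]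

theorem enc_exists (A : Set ℕ) (hA : ∀ i ∈ A, i < 9) :
    ∃ n ∈ List.range 512, n.testBit = chi A := by
  refine ⟨Nat.ofBits (fun i : Fin 9 => chi A i), ?_, ?_⟩
  · rw [List.mem_range]
    exact Nat.ofBits_lt_two_pow _
  · apply chi_eq
    intro i
    by_cases hi : i < 9
    · rw [Nat.testBit_ofBits_lt _ _ hi, chi_iff]
    · rw [Nat.testBit_ofBits_ge _ _ (not_lt.1 hi)]
      simp only [Bool.false_eq_true, false_iff]
      exact fun h => hi (hA i h)

def IsE (p q : ℕ) (e : ℕ × ℕ) : Prop := (e.1 = p ∧ e.2 = q) ∨ (e.1 = q ∧ e.2 = p)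

theorem isE_iff {p q : ℕ} {e : ℕ × ℕ} : isE p q e = true ↔ IsE p q e := by
  simp [isE, IsE]

/-- Propositional version of `known`. -/
def Kn (k : Cfg) (A S B : Set ℕ) (e : ℕ × ℕ) : Prop :=
  (e.1 ∈ S ∨ e.2 ∈ S) ∨
  ((e.1 ≠ k.c ∧ e.2 ≠ k.c) ∧ ((e.1 ∈ A ∧ e.2 ∈ B) ∨ (e.1 ∈ B ∧ e.2 ∈ A))) ∨
  (k.g = false ∧ ((IsE k.c k.n1 e ∧ k.n1 ∉ A) ∨ (IsE k.c k.n2 e ∧ k.n2 ∉ B)))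

theorem known_iff {k : Cfg} {A S B : Set ℕ} {e : ℕ × ℕ} :
    known k (chi A) (chi S) (chi B) e = true ↔ Kn k A S B e := by
  simp only [known, Kn, NWB.touch, notAt, Bool.or_eq_true, Bool.and_eq_true, chi_iff, isE_iff,
    Bool.not_eq_true', chi_false, bne_iff_ne, or_assoc]

/-- Propositional version of `badC`. -/
structure Bad (k : Cfg) (A S B : Set ℕ) (R : Set (ℕ × ℕ)) : Prop where
  cover : ∀ i < 9, i = k.c ∨ i ∈ A ∨ i ∈ S ∨ i ∈ B
  hc : k.g = true ∨ k.c ∉ S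
  cA : cntC k.c (chi A) ≤ k.th
  cB : cntC k.c (chi B) ≤ k.th
  dem : k.g = true ∨ ((k.n1 ∈ A ∨ k.c ∈ A) ∧ (k.n2 ∈ B ∨ k.c ∈ B))
  kn : ∀ e ∈ gE, Kn k A S B e → e ∈ R

theorem bad_of {k : Cfg} {A S B : Set ℕ} {r : ℕ × ℕ → Bool} {R : Set (ℕ × ℕ)}
    (h : badC k (chi A) (chi S) (chi B) r = true) (hr : ∀ e ∈ gE, r e = true → e ∈ R) :
    Bad k A S B R := by
  simp only [badC, Bool.and_eq_true, List.all_eq_true, List.mem_range, Bool.or_eq_true,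
    beq_iff_eq, chi_iff, Bool.not_eq_true', chi_false, decide_eq_true_eq] at h
  obtain ⟨⟨⟨⟨⟨h1, h2⟩, h3⟩, h4⟩, h5⟩, h6⟩ := h
  refine ⟨fun i hi => ?_, h2, h3, h4, h5, fun e he hk => ?_⟩
  · have := h1 i hi
    tauto
  · rcases h6 e he with h | h
    · rw [known_iff.2 hk] at h
      cases h
    · exact hr e he h

theorem cfg_facts : ∀ k ∈ cfgs, (k.g = true → k.c = 9) ∧ (k.g = false → k.c < 9 ∧ k.n1 < 9 ∧
    k.n2 < 9 ∧ k.n1 ≠ k.c ∧ k.n2 ≠ k.c) := by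
  simp [cfgs]

theorem gE_lt : ∀ e ∈ gE, e.1 < 9 ∧ e.2 < 9 := by decide

theorem cntC_mono {c : ℕ} {f g : ℕ → Bool}
    (h : ∀ i < 9, i ≠ c → f i = true → g i = true) : cntC c f ≤ cntC c g := by
  unfold cntC
  apply List.countP_mono_left
  intro i hi
  simp only [Bool.and_eq_true, bne_iff_ne]
  rintro ⟨h1, h2⟩
  exact ⟨h i (List.mem_range.1 hi) h2 h1, h2⟩

/-! ### Pigeonhole -/

theorem noTri_of (T : List (Bool × ℕ × ℕ)) (f : Bool × ℕ × ℕ → ℕ)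
    (h : ∀ t ∈ T, f t < 2) (h' : ∀ t ∈ T, ∀ u ∈ T, f t = f u → shareT t u = true) :
    noTri T = true := by
  simp only [noTri, List.all_eq_true, Bool.or_eq_true]
  intro t ht u hu
  by_cases e1 : f t = f u
  · exact Or.inl (h' t ht u hu e1)
  · right
    intro v hv
    have := h t ht
    have := h u hu
    have := h v hv
    by_cases e2 : f t = f v
    · exact Or.inl (h' t ht v hv e2)
    · exact Or.inr (h' u hu v hv (by omega))

theorem noTri_cov {n : ℕ} (hn : n ≤ 2) {R : Set (ℕ × ℕ)} {B : Set ℕ} (hc : Cov n R B)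
    (L : List (ℕ × ℕ)) (hL : ∀ e ∈ L, e ∈ R ∧ Crs B e) : noTri (tagL true L) = true := by
  obtain ⟨f, hf⟩ := hc
  apply noTri_of _ (fun t => f t.2)
  · intro t ht
    simp only [tagL, List.mem_map] at ht
    obtain ⟨e, he, rfl⟩ := ht
    exact ((hf e (hL e he).1 (hL e he).2).1).trans_le hn
  · intro t ht u hu
    simp only [tagL, List.mem_map] at ht hu
    obtain ⟨e, he, rfl⟩ := ht
    obtain ⟨e', he', rfl⟩ := hu
    intro h
    have := (hf e (hL e he).1 (hL e he).2).2 e' (hL e' he').1 (hL e' he').2 h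
    simpa [shareT] using this

theorem noTri_cov2 {m n : ℕ} (hn : m + n ≤ 2) {R R' : Set (ℕ × ℕ)} {B : Set ℕ} (hc : Cov m R B)
    (hc' : Cov n R' B) (L L' : List (ℕ × ℕ)) (hL : ∀ e ∈ L, e ∈ R ∧ Crs B e)
    (hL' : ∀ e ∈ L', e ∈ R' ∧ Crs B e) : noTri (tagL true L ++ tagL false L') = true := by
  obtain ⟨f, hf⟩ := hc
  obtain ⟨g, hg⟩ := hc'
  apply noTri_of _ (fun t => if t.1 then f t.2 else m + g t.2)
  · intro t ht
    simp only [tagL, List.mem_map, List.mem_append] at ht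
    rcases ht with ⟨e, he, rfl⟩ | ⟨e, he, rfl⟩
    · have := (hf e (hL e he).1 (hL e he).2).1
      simp only [if_true]
      omega
    · have := (hg e (hL' e he).1 (hL' e he).2).1
      simp only [Bool.false_eq_true, if_false]
      omega
  · intro t ht u hu
    simp only [tagL, List.mem_map, List.mem_append] at ht hu
    rcases ht with ⟨e, he, rfl⟩ | ⟨e, he, rfl⟩ <;> rcases hu with ⟨e', he', rfl⟩ | ⟨e', he', rfl⟩
    · intro h
      have := (hf e (hL e he).1 (hL e he).2).2 e' (hL e' he').1 (hL e' he').2 h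
      simpa [shareT] using this
    · intro h
      have := (hf e (hL e he).1 (hL e he).2).1
      simp only [if_true, Bool.false_eq_true, if_false] at h
      omega
    · intro h
      have := (hf e' (hL e' he').1 (hL e' he').2).1
      simp only [if_true, Bool.false_eq_true, if_false] at h
      omega
    · intro h
      simp only [Bool.false_eq_true, if_false] at h
      have := (hg e (hL' e he).1 (hL' e he).2).2 e' (hL' e' he').1 (hL' e' he').2 (by omega)
      simpa [shareT] using this

/-! ### Leaf -/

theorem countP_or3 (L : List ℕ) (p q r s : ℕ → Bool)
    (h : ∀ i ∈ L, p i = true → q i = true ∨ r i = true ∨ s i = true) :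
    L.countP p ≤ L.countP q + L.countP r + L.countP s := by
  induction L with
  | nil => simp
  | cons a L ih =>
    have := ih (fun i hi => h i (List.mem_cons_of_mem _ hi))
    have h0 := h a List.mem_cons_self
    simp only [List.countP_cons]
    by_cases hp : p a = true
    · rcases h0 hp with h1 | h1 | h1 <;> simp only [hp, h1, if_true] <;> omega
    · simp only [hp]
      simp only [Bool.false_eq_true, if_false]
      omega

theorem cntC_le_ncard (c : ℕ) (S : Set ℕ) (hS : S.Finite) : cntC c (chi S) ≤ S.ncard := by
  have h1 : cntC c (chi S) = ((Finset.range 9).filter (fun i => (chi S i && i != c) = true)).card := by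
    rw [Finset.card_filter, Finset.sum_range]
    unfold cntC
    simp only [Fin.sum_univ_succ, List.countP_eq_length_filter]
    rw [← List.countP_eq_length_filter]
    simp only [List.range, List.range.loop, List.countP_cons, List.countP_nil]
    simp
    omega
  rw [h1, ← Set.ncard_coe_finset]
  apply Set.ncard_le_ncard _ hS
  intro i hi
  simp only [Finset.coe_filter, Set.mem_setOf_eq, Bool.and_eq_true, chi_iff] at hi
  exact hi.2.1

theorem bad_leaf {k : Cfg} (hk : k ∈ cfgs) {A S B : Set ℕ} {R : Set (ℕ × ℕ)} (h : Bad k A S B R)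
    (hS : S.Finite) : 3 ≤ S.ncard := by
  have h1 := cntC_le_ncard k.c S hS
  have h2 : cntC k.c (fun _ => true) ≤ cntC k.c (chi A) + cntC k.c (chi S) + cntC k.c (chi B) := by
    apply countP_or3
    intro i hi h'
    simp only [Bool.and_eq_true, bne_iff_ne, chi_iff] at h' ⊢
    rcases h.cover i (List.mem_range.1 hi) with h0 | h0 | h0 | h0
    · exact (h'.2 h0).elim
    all_goals simp [h0, h'.2]
  have h3 := h.cA
  have h4 := h.cB
  have h5 : ∀ k ∈ cfgs, 3 + k.th + k.th ≤ cntC k.c (fun _ => true) := by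
    simp [cfgs, cntC, List.range, List.range.loop]
  have := h5 k hk
  omega


theorem chi_ne {A : Set ℕ} {i j : ℕ} : chi A i ≠ chi A j ↔ ¬ (i ∈ A ↔ j ∈ A) := by
  rw [ne_eq, Bool.eq_iff_iff, chi_iff, chi_iff]

theorem nchi_ne {A : Set ℕ} {i j : ℕ} : (!chi A i) ≠ (!chi A j) ↔ ¬ (i ∈ A ↔ j ∈ A) := by
  rw [← chi_ne]; simp

/-! ### The sequential step -/

theorem mid_known {k : Cfg} (hk : k ∈ cfgs) {A S B K : Set ℕ} {R : Set (ℕ × ℕ)}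
    (h : Bad k A S B R) (hU : ∀ i, i ∈ A ∨ i ∈ S ∨ i ∈ B → i < 9) (dAB : Disjoint A B)
    (hAK : A ⊆ K) (hKS : K ⊆ A ∪ S) (dKB : Disjoint K B)
    {e : ℕ × ℕ} (he : e ∈ gE) (hm : midE k (chi K) e = true) :
    e ∈ R ∧ ¬ (e.1 ∈ K ↔ e.2 ∈ K) ∧ (e.1 ∈ A ∨ e.1 ∈ S ∨ e.1 ∈ B) ∧
      (e.2 ∈ A ∨ e.2 ∈ S ∨ e.2 ∈ B) := by
  obtain ⟨-, c2⟩ := cfg_facts k hk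
  obtain ⟨l1, l2⟩ := gE_lt e he
  rw [Set.disjoint_left] at dAB dKB
  simp only [midE, notAt, Bool.or_eq_true, Bool.and_eq_true, bne_iff_ne, isE_iff,
    Bool.not_eq_true', chi_false, chi_iff, chi_ne] at hm
  rcases hm with ⟨⟨m1, m2⟩, m3⟩ | ⟨m1, m3⟩
  · have q1 := (h.cover _ l1).resolve_left m1
    have q2 := (h.cover _ l2).resolve_left m2
    refine ⟨h.kn e he ?_, m3, q1, q2⟩
    rcases q1 with q1 | q1 | q1
    · rcases q2 with q2 | q2 | q2
      · exact (m3 ⟨fun _ => hAK q2, fun _ => hAK q1⟩).elim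
      · exact Or.inl (Or.inr q2)
      · exact Or.inr (Or.inl ⟨⟨m1, m2⟩, Or.inl ⟨q1, q2⟩⟩)
    · exact Or.inl (Or.inl q1)
    · rcases q2 with q2 | q2 | q2
      · exact Or.inr (Or.inl ⟨⟨m1, m2⟩, Or.inr ⟨q1, q2⟩⟩)
      · exact Or.inl (Or.inr q2)
      · exact (m3 ⟨fun h => (dKB h q1).elim, fun h => (dKB h q2).elim⟩).elim
  · obtain ⟨b1, b2, b3, b4, b5⟩ := c2 m1
    obtain ⟨d1, d2⟩ := h.dem.resolve_left (by simp [m1])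
    rcases m3 with ⟨m3, m4⟩ | ⟨m3, m4⟩
    · have a1 : k.n1 ∉ A := fun h => m4 (hAK h)
      have a2 := d1.resolve_left a1
      have a3 := (h.cover _ b2).resolve_left b4
      have a4 := hAK a2
      refine ⟨h.kn e he (Or.inr (Or.inr ⟨m1, Or.inl ⟨m3, a1⟩⟩)), ?_⟩
      rcases m3 with ⟨e1, e2⟩ | ⟨e1, e2⟩ <;> rw [e1, e2] <;> grind
    · have a1 : k.n2 ∉ B := fun h => dKB m4 h
      have a2 := d2.resolve_left a1
      have a3 := (h.cover _ b3).resolve_left b5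
      have a4 : k.c ∉ K := fun h => dKB h a2
      refine ⟨h.kn e he (Or.inr (Or.inr ⟨m1, Or.inr ⟨m3, a1⟩⟩)), ?_⟩
      rcases m3 with ⟨e1, e2⟩ | ⟨e1, e2⟩ <;> rw [e1, e2] <;> grind

theorem seq_step {k : Cfg} (hk : k ∈ cfgs) {A SX SY B : Set ℕ} {R RX RY : Set (ℕ × ℕ)} {m : ℕ}
    (hm : m ≤ 2)
    (h : Bad k A (SX ∪ SY) B R) (hU : ∀ i, i ∈ A ∨ i ∈ SX ∪ SY ∨ i ∈ B → i < 9)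
    (d1 : Disjoint A SX) (d2 : Disjoint (A ∪ SX) SY) (d3 : Disjoint (A ∪ SX) B)
    (d4 : Disjoint SY B)
    (hR : ∀ e ∈ R, Crs (SY ∪ B) e → e ∈ RX ∧ e ∈ RY)
    (tX : ∀ e ∈ gE, (e.1 ∈ SX ∨ e.2 ∈ SX) → e ∈ RX)
    (tY : ∀ e ∈ gE, (e.1 ∈ SY ∨ e.2 ∈ SY) → e ∈ RY)
    (cov : Cov m RX (SY ∪ B)) :
    Bad k A SX (SY ∪ B) RX ∨ Bad k (A ∪ SX) SY B RY := by
  obtain ⟨-, c2⟩ := cfg_facts k hk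
  have dAB : Disjoint A B := d3.mono_left Set.subset_union_left
  obtain ⟨n, hn, hnK⟩ := enc_exists (A ∪ SX) (fun i hi => hU i (by
    simp only [Set.mem_union] at hi ⊢; grind))
  have hmid : midOK k n = true := by
    unfold midOK
    apply noTri_cov hm cov
    intro e he
    rw [List.mem_filter, hnK] at he
    obtain ⟨h1, h2, h3, h4⟩ := mid_known hk h hU dAB Set.subset_union_left
      (Set.union_subset_union_right _ Set.subset_union_left) d3 he.1 he.2
    have hcr : Crs (SY ∪ B) e := by
      rw [Set.disjoint_left] at d2 d3
      have x1 := @d2 e.1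
      have x2 := @d2 e.2
      have x3 := @d3 e.1
      have x4 := @d3 e.2
      unfold Crs
      simp only [Set.mem_union] at h2 h3 h4 x1 x2 x3 x4 ⊢
      grind
    exact ⟨(hR e h1 hcr).1, hcr⟩
  have hck := mid_check
  rw [List.all_eq_true] at hck
  have hck := hck k hk
  rw [List.all_eq_true] at hck
  have hck := hck n hn
  rw [hmid, hnK] at hck
  simp only [Bool.not_true, Bool.false_or, Bool.or_eq_true, decide_eq_true_eq] at hck
  rw [Set.disjoint_left] at d1 d2 d3 d4 dAB
  rcases hck with hck | hck
  · right
    refine ⟨?_, ?_, hck, h.cB, ?_, ?_⟩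
    · intro i hi
      have := h.cover i hi
      simp only [Set.mem_union] at this ⊢
      grind
    · exact h.hc.imp_right fun h1 h2 => h1 (Or.inr h2)
    · exact h.dem.imp_right fun h1 => ⟨h1.1.imp Or.inl Or.inl, h1.2⟩
    · intro e he hkn
      rcases hkn with hkn | ⟨hne, hkn⟩ | ⟨hg, hkn⟩
      · exact tY e he hkn
      · have hk1 : Kn k A (SX ∪ SY) B e := by
          unfold Kn
          simp only [Set.mem_union] at hkn ⊢
          grind
        refine (hR e (h.kn e he hk1) ?_).2
        have x1 := @d2 e.1
        have x2 := @d2 e.2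
        have x3 := @d3 e.1
        have x4 := @d3 e.2
        unfold Crs
        simp only [Set.mem_union] at hkn x1 x2 x3 x4 ⊢
        grind
      · obtain ⟨b1, b2, b3, b4, b5⟩ := c2 hg
        obtain ⟨q1, q2⟩ := h.dem.resolve_left (by simp [hg])
        rcases hkn with ⟨m3, m4⟩ | ⟨m3, m4⟩
        · have a1 : k.n1 ∉ A := fun h => m4 (Or.inl h)
          have a2 := q1.resolve_left a1
          have a3 := (h.cover _ b2).resolve_left b4
          have a5 := h.kn e he (Or.inr (Or.inr ⟨hg, Or.inl ⟨m3, a1⟩⟩))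
          refine (hR e a5 ?_).2
          have a6 : k.n1 ∈ SY ∪ B := by
            simp only [Set.mem_union] at a3 m4 ⊢
            grind
          have a7 : k.c ∉ SY ∪ B := by
            have x1 := @d2 k.c
            have x3 := @d3 k.c
            simp only [Set.mem_union] at x1 x3 ⊢
            grind
          unfold Crs
          rcases m3 with ⟨e1, e2⟩ | ⟨e1, e2⟩ <;> rw [e1, e2] <;> grind
        · have a2 := q2.resolve_left m4
          have a3 := (h.cover _ b3).resolve_left b5
          have a5 := h.kn e he (Or.inr (Or.inr ⟨hg, Or.inr ⟨m3, m4⟩⟩))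
          by_cases a6 : k.n2 ∈ SY
          · apply tY e he
            rcases m3 with ⟨e1, e2⟩ | ⟨e1, e2⟩ <;> rw [e1, e2] <;> grind
          refine (hR e a5 ?_).2
          have a6 : k.n2 ∉ SY ∪ B := by
            simp only [Set.mem_union]
            grind
          have a7 : k.c ∈ SY ∪ B := Or.inr a2
          unfold Crs
          rcases m3 with ⟨e1, e2⟩ | ⟨e1, e2⟩ <;> rw [e1, e2] <;> grind
  · left
    refine ⟨?_, ?_, h.cA, ?_, ?_, ?_⟩
    · intro i hi
      have := h.cover i hi
      simp only [Set.mem_union] at this ⊢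
      grind
    · exact h.hc.imp_right fun h1 h2 => h1 (Or.inl h2)
    · refine (cntC_mono ?_).trans hck
      intro i _ _ hi
      rw [chi_iff] at hi
      rw [Bool.not_eq_true', chi_false]
      intro h'
      rcases hi with hi | hi
      · exact d2 h' hi
      · exact d3 h' hi
    · exact h.dem.imp_right fun h1 => ⟨h1.1, h1.2.imp Or.inr Or.inr⟩
    · intro e he hkn
      rcases hkn with hkn | ⟨hne, hkn⟩ | ⟨hg, hkn⟩
      · exact tX e he hkn
      · have hk1 : Kn k A (SX ∪ SY) B e := by
          unfold Kn
          simp only [Set.mem_union] at hkn ⊢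
          grind
        refine (hR e (h.kn e he hk1) ?_).1
        have x1 := @d2 e.1
        have x2 := @d2 e.2
        have x3 := @d3 e.1
        have x4 := @d3 e.2
        unfold Crs
        simp only [Set.mem_union] at hkn x1 x2 x3 x4 ⊢
        grind
      · obtain ⟨b1, b2, b3, b4, b5⟩ := c2 hg
        obtain ⟨q1, q2⟩ := h.dem.resolve_left (by simp [hg])
        rcases hkn with ⟨m3, m4⟩ | ⟨m3, m4⟩
        · have a2 := q1.resolve_left m4
          have a3 := (h.cover _ b2).resolve_left b4
          have a5 := h.kn e he (Or.inr (Or.inr ⟨hg, Or.inl ⟨m3, m4⟩⟩))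
          by_cases a6 : k.n1 ∈ SX
          · apply tX e he
            rcases m3 with ⟨e1, e2⟩ | ⟨e1, e2⟩ <;> rw [e1, e2] <;> grind
          refine (hR e a5 ?_).1
          have a6 : k.n1 ∈ SY ∪ B := by
            simp only [Set.mem_union] at a3 ⊢
            grind
          have a7 : k.c ∉ SY ∪ B := by
            have x1 := @d2 k.c
            have x3 := @d3 k.c
            simp only [Set.mem_union] at x1 x3 ⊢
            grind
          unfold Crs
          rcases m3 with ⟨e1, e2⟩ | ⟨e1, e2⟩ <;> rw [e1, e2] <;> grind
        · have a1 : k.n2 ∉ B := fun h => m4 (Or.inr h)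
          have a2 := q2.resolve_left a1
          have a5 := h.kn e he (Or.inr (Or.inr ⟨hg, Or.inr ⟨m3, a1⟩⟩))
          refine (hR e a5 ?_).1
          have a7 : k.c ∈ SY ∪ B := Or.inr a2
          unfold Crs
          rcases m3 with ⟨e1, e2⟩ | ⟨e1, e2⟩ <;> rw [e1, e2] <;> grind

/-! ### The tensor step -/

theorem goX_sound (fin : List ℕ → List ℕ → Bool) (x : ℕ → Bool) (Z : ℕ → Prop)
    (hadj : ∀ i j, Z i → Z j → x i = true → x j = false → adjB i j = false ∧ adjB j i = false) :
    ∀ (l xs ys : List ℕ), (∀ i ∈ l, Z i) → (∀ i ∈ xs, Z i ∧ x i = true) →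
      (∀ i ∈ ys, Z i ∧ x i = false) → goX fin l xs ys = true →
      fin ((l.filter x).reverse ++ xs) ((l.filter (fun i => !x i)).reverse ++ ys) = true := by
  intro l
  induction l with
  | nil =>
    intro xs ys _ _ _ h
    simpa [goX] using h
  | cons i l ih =>
    intro xs ys hl hx hy h
    simp only [goX, Bool.and_eq_true, Bool.or_eq_true] at h
    obtain ⟨h1, h2⟩ := h
    have hi := hl i List.mem_cons_self
    have hl' : ∀ j ∈ l, Z j := fun j hj => hl j (List.mem_cons_of_mem _ hj)
    cases hxi : x i
    · have h3 : ¬ (xs.any (adjB i) = true) := by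
        rw [List.any_eq_true]
        rintro ⟨j, hj, hj'⟩
        rw [(hadj j i (hx j hj).1 hi (hx j hj).2 hxi).2] at hj'
        cases hj'
      have := ih xs (i :: ys) hl' hx (by
        intro j hj
        rcases List.mem_cons.1 hj with rfl | hj
        · exact ⟨hi, hxi⟩
        · exact hy j hj) (h2.resolve_left h3)
      simpa [List.filter_cons, hxi] using this
    · have h3 : ¬ (ys.any (adjB i) = true) := by
        rw [List.any_eq_true]
        rintro ⟨j, hj, hj'⟩
        rw [(hadj i j hi (hy j hj).1 hxi (hy j hj).2).1] at hj'
        cases hj'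
      have := ih (i :: xs) ys hl' (by
        intro j hj
        rcases List.mem_cons.1 hj with rfl | hj
        · exact ⟨hi, hxi⟩
        · exact hx j hj) hy (h1.resolve_left h3)
      simpa [List.filter_cons, hxi] using this

theorem crossE_iff {A : Set ℕ} {e : ℕ × ℕ} : crossE (chi A) e = true ↔ Crs A e := by
  simp only [crossE, bne_iff_ne, chi_ne, Crs]

theorem touch_iff {A : Set ℕ} {e : ℕ × ℕ} : NWB.touch (chi A) e = true ↔ (e.1 ∈ A ∨ e.2 ∈ A) := by
  simp only [NWB.touch, Bool.or_eq_true, chi_iff]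

theorem cand_mem {k : Cfg} (hk : k ∈ cfgs) {A S B : Set ℕ} {R : Set (ℕ × ℕ)} {l r : ℕ}
    (hl : l ≤ 2) (hr : r ≤ 2)
    (h : Bad k A S B R) (hU : ∀ i, i ∈ A ∨ i ∈ S ∨ i ∈ B → i < 9)
    (dAS : Disjoint A S) (dAB : Disjoint A B) (dSB : Disjoint S B)
    (cl : Cov l R A) (cr : Cov r R B) {a b : ℕ} (ha : a ∈ List.range 512)
    (hb : b ∈ List.range 512) (ha' : a.testBit = chi A) (hb' : b.testBit = chi B) :
    a ∈ candA k ∧ b ∈ candB k := by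
  have hck := cand_check
  rw [List.all_eq_true] at hck
  have hck := hck k hk
  rw [List.all_eq_true] at hck
  constructor
  · have h1 := hck a ha
    have hmid : midOK k a = true := by
      unfold midOK
      apply noTri_cov hl cl
      intro e he
      rw [List.mem_filter, ha'] at he
      obtain ⟨h1, h2, h3, h4⟩ := mid_known hk h hU dAB subset_rfl
        Set.subset_union_left dAB he.1 he.2
      exact ⟨h1, h2⟩
    rw [hmid, ha'] at h1
    simp only [Bool.and_eq_true, Bool.or_eq_true, Bool.not_eq_true', decide_eq_false_iff_not,
      Bool.not_true, Bool.false_or, List.contains_iff_mem] at h1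
    exact (h1.resolve_left (not_not.2 h.cA)).1
  · have h1 := hck b hb
    rw [hb'] at h1
    have hmid : noTri (tagL true (gE.filter (midE k (fun i => !chi B i)))) = true := by
      apply noTri_cov hr cr
      intro e he
      rw [List.mem_filter] at he
      obtain ⟨c1, c2⟩ := cfg_facts k hk
      have hm : midE k (chi (A ∪ S)) e = true := by
        have hm := he.2
        obtain ⟨l1, l2⟩ := gE_lt e he.1
        rw [Set.disjoint_left] at dAS dAB dSB
        have key : ∀ i < 9, i ≠ k.c → (i ∈ A ∪ S ↔ i ∉ B) := by
          intro i hi hc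
          have x1 := h.cover i hi
          have x2 := @dAB i
          have x3 := @dSB i
          simp only [Set.mem_union]
          grind
        simp only [midE, notAt, Bool.or_eq_true, Bool.and_eq_true, bne_iff_ne, isE_iff,
          Bool.not_eq_true', chi_false, chi_iff, chi_ne, nchi_ne, Bool.not_eq_false'] at hm ⊢
        rcases hm with ⟨⟨m1, m2⟩, m3⟩ | ⟨m1, m3⟩
        · left
          rw [key _ l1 m1, key _ l2 m2]
          exact ⟨⟨m1, m2⟩, by grind⟩
        · right
          obtain ⟨b1, b2, b3, b4, b5⟩ := c2 (by simpa using m1)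
          rw [key _ b2 b4, key _ b3 b5]
          exact ⟨m1, by grind⟩
      obtain ⟨h1, h2, h3, h4⟩ := mid_known hk h hU dAB Set.subset_union_left
        subset_rfl (Set.disjoint_union_left.2 ⟨dAB, dSB⟩) he.1 hm
      refine ⟨h1, ?_⟩
      rw [Set.disjoint_left] at dAS dAB dSB
      have x1 := @dAB e.1
      have x2 := @dAB e.2
      have x3 := @dSB e.1
      have x4 := @dSB e.2
      unfold Crs
      simp only [Set.mem_union] at h2 ⊢
      grind
    rw [hmid] at h1
    simp only [Bool.and_eq_true, Bool.or_eq_true, Bool.not_eq_true', decide_eq_false_iff_not,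
      Bool.not_true, Bool.false_or, List.contains_iff_mem] at h1
    exact (h1.resolve_left (not_not.2 h.cB)).2

open Classical in
theorem ten_step {k : Cfg} (hk : k ∈ cfgs) {A SX SY B : Set ℕ} {R RX RY : Set (ℕ × ℕ)}
    {l1 l2 r1 r2 : ℕ} (hl : l1 + l2 ≤ 2) (hr : r1 + r2 ≤ 2)
    (h : Bad k A (SX ∪ SY) B R) (hU : ∀ i, i ∈ A ∨ i ∈ SX ∪ SY ∨ i ∈ B → i < 9)
    (dAS : Disjoint A (SX ∪ SY)) (dAB : Disjoint A B) (dSB : Disjoint (SX ∪ SY) B)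
    (dXY : Disjoint SX SY)
    (cl : Cov (l1 + l2) R A) (cr : Cov (r1 + r2) R B)
    (hR : ∀ e ∈ R, e ∈ RX ∨ e ∈ RY)
    (tX : ∀ e ∈ gE, (e.1 ∈ SX ∨ e.2 ∈ SX) → e ∈ RX)
    (tY : ∀ e ∈ gE, (e.1 ∈ SY ∨ e.2 ∈ SY) → e ∈ RY)
    (sX : ∀ e ∈ RX, e.1 ∈ A ∪ SX ∪ B ∧ e.2 ∈ A ∪ SX ∪ B)
    (clX : Cov l1 RX A) (clY : Cov l2 RY A) (crX : Cov r1 RX B) (crY : Cov r2 RY B) :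
    (∃ k' ∈ cfgs, Bad k' A SX B RX) ∨ (∃ k' ∈ cfgs, Bad k' A SY B RY) := by
  obtain ⟨c1, c2⟩ := cfg_facts k hk
  obtain ⟨a, ha, ha'⟩ := enc_exists A (fun i hi => hU i (Or.inl hi))
  obtain ⟨b, hb, hb'⟩ := enc_exists B (fun i hi => hU i (Or.inr (Or.inr hi)))
  obtain ⟨ca, cb⟩ := cand_mem hk hl hr h hU dAS dAB dSB cl cr ha hb ha' hb'
  have hab : a &&& b = 0 := by
    apply Nat.eq_of_testBit_eq
    intro i
    rw [Nat.testBit_and, ha', hb', Nat.zero_testBit, Bool.eq_false_iff]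
    simp only [ne_eq, Bool.and_eq_true, chi_iff, not_and]
    exact fun h1 h2 => Set.disjoint_left.1 dAB h1 h2
  have hck := ten_check
  rw [List.all_eq_true] at hck
  have hck := hck k hk
  rw [List.all_eq_true] at hck
  have hck := hck a ca
  rw [List.all_eq_true] at hck
  have hck := hck b cb
  have hdem : (k.g || ((a.testBit k.n1 || a.testBit k.c) &&
      (b.testBit k.n2 || b.testBit k.c))) = true := by
    rw [ha', hb']
    simp only [Bool.or_eq_true, Bool.and_eq_true, chi_iff]
    exact h.dem
  rw [hdem, hab, ha', hb'] at hck
  simp only [bne_self_eq_false, Bool.not_true, Bool.false_or] at hck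
  rw [Set.disjoint_left] at dAS dAB dSB dXY
  have hrest : ∀ i, i ∈ rest k (chi A) (chi B) ↔ i ∈ SX ∪ SY := by
    intro i
    have h9 : i ∈ [0,1,2,3,4,5,6,7,8] ↔ i < 9 := by
      simp only [List.mem_cons, List.not_mem_nil, or_false]
      omega
    simp only [rest, List.mem_filter, h9, Bool.and_eq_true, bne_iff_ne, Bool.not_eq_true',
      chi_false]
    constructor
    · rintro ⟨q1, ⟨q2, q3⟩, q4⟩
      have := h.cover i q1
      grind
    · intro hi
      have q1 := hU i (Or.inr (Or.inl hi))
      refine ⟨q1, ⟨?_, fun h => dAS h hi⟩, fun h => dSB hi h⟩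
      rintro rfl
      rcases h.hc with h' | h'
      · rw [c1 h'] at q1
        omega
      · exact h' hi
  have hfin := goX_sound _ (chi SX) (fun i => i ∈ SX ∪ SY) (by
    have key : ∀ i j, i ∈ SX → j ∈ SX ∪ SY → j ∉ SX → ∀ e ∈ gE, ¬ IsE i j e := by
      intro i j hi hj hj' e he hE
      have hjY : j ∈ SY := hj.resolve_left hj'
      have m1 : e ∈ RX := by
        apply tX e he
        rcases hE with ⟨e1, e2⟩ | ⟨e1, e2⟩ <;> rw [e1, e2] <;> grind
      have hjj : j ∈ A ∪ SX ∪ B := by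
        rcases hE with ⟨e1, e2⟩ | ⟨e1, e2⟩
        · exact e2 ▸ (sX e m1).2
        · exact e1 ▸ (sX e m1).1
      rcases hjj with (q | q) | q
      · exact dAS q hj
      · exact hj' q
      · exact dSB hj q
    intro i j hi hj xi xj
    rw [chi_iff] at xi
    rw [chi_false] at xj
    simp only [adjB, Bool.eq_false_iff, ne_eq, List.any_eq_true, not_exists, not_and, isE_iff]
    refine ⟨fun e he => key i j xi hj xj e he, fun e he hE => key i j xi hj xj e he ?_⟩
    exact hE.symm.imp And.symm And.symm |> fun h => by
      unfold IsE at hE ⊢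
      grind)
    _ [] [] (fun i hi => (hrest i).1 hi) (by simp) (by simp) hck
  unfold tenX at hfin
  have hxs : (((rest k (chi A) (chi B)).filter (chi SX)).reverse ++ []).contains = chi SX := by
    apply chi_eq
    intro i
    simp only [List.append_nil, List.contains_iff_mem, List.mem_reverse, List.mem_filter, hrest,
      chi_iff]
    exact ⟨fun h => h.2, fun h => ⟨Or.inl h, h⟩⟩
  have hys : (((rest k (chi A) (chi B)).filter (fun i => !chi SX i)).reverse ++ []).contains =
      chi SY := by
    apply chi_eq
    intro i
    simp only [List.append_nil, List.contains_iff_mem, List.mem_reverse, List.mem_filter, hrest,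
      chi_iff, Bool.not_eq_true', chi_false]
    exact ⟨fun h => h.1.resolve_left h.2, fun h => ⟨Or.inr h, fun h' => dXY h' h⟩⟩
  have hxy : (fun i => chi SX i || chi SY i) = chi (SX ∪ SY) := by
    apply chi_eq
    intro i
    simp only [Bool.or_eq_true, chi_iff, Set.mem_union]
  rw [hxs, hys, hxy] at hfin
  set U := gE.filter (fun e => known k (chi A) (chi (SX ∪ SY)) (chi B) e &&
    !NWB.touch (chi (SX ∪ SY)) e) with hUdef
  have hUR : ∀ e ∈ U, e ∈ gE ∧ e ∈ R := by
    intro e he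
    rw [hUdef, List.mem_filter, Bool.and_eq_true, known_iff] at he
    exact ⟨he.1, h.kn e he.1 he.2.1⟩
  unfold tenFin at hfin
  rw [List.all_eq_true] at hfin
  set p1 := U.filter (fun e => decide (e ∈ RX)) with hp1
  have hfin := hfin p1 (List.mem_sublists.2 List.filter_sublist)
  set p2 := U.filter (fun e => !p1.contains e) with hp2
  have m1 : ∀ e ∈ p1, e ∈ RX := by
    intro e he
    rw [hp1, List.mem_filter] at he
    simpa using he.2
  have m2 : ∀ e ∈ p2, e ∈ RY := by
    intro e he
    rw [hp2, List.mem_filter, Bool.not_eq_true', Bool.eq_false_iff, ne_eq,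
      List.contains_iff_mem] at he
    have hx : e ∉ RX := by
      intro h'
      apply he.2
      rw [hp1, List.mem_filter]
      exact ⟨he.1, by simpa using h'⟩
    exact (hR e (hUR e he.1).2).resolve_left hx
  have n1 : ∀ e ∈ gE, (NWB.touch (chi SX) e || p1.contains e) = true → e ∈ RX := by
    intro e he h'
    rw [Bool.or_eq_true, touch_iff, List.contains_iff_mem] at h'
    exact h'.elim (tX e he) (m1 e)
  have n2 : ∀ e ∈ gE, (NWB.touch (chi SY) e || p2.contains e) = true → e ∈ RY := by
    intro e he h'
    rw [Bool.or_eq_true, touch_iff, List.contains_iff_mem] at h'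
    exact h'.elim (tY e he) (m2 e)
  have tag : ∀ (C : Set ℕ) (x y : ℕ), x + y ≤ 2 → Cov x RX C → Cov y RY C →
      noTri (tagged (chi C) (chi SX) (chi SY) p1 p2) = true := by
    intro C x y hxy cx cy
    unfold tagged
    apply noTri_cov2 hxy cx cy
    · intro e he
      rw [List.mem_filter, Bool.and_eq_true, crossE_iff] at he
      exact ⟨n1 e he.1 he.2.2, he.2.1⟩
    · intro e he
      rw [List.mem_filter, Bool.and_eq_true, crossE_iff] at he
      exact ⟨n2 e he.1 he.2.2, he.2.1⟩
  rw [tag A l1 l2 hl clX clY, tag B r1 r2 hr crX crY] at hfin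
  simp only [Bool.not_true, Bool.false_or, Bool.or_eq_true, List.any_eq_true] at hfin
  rcases hfin with ⟨k', hk', hb⟩ | ⟨k', hk', hb⟩
  · exact Or.inl ⟨k', hk', bad_of hb n1⟩
  · exact Or.inr ⟨k', hk', bad_of hb n2⟩


/-! ### The induction over wiring expressions -/

theorem Sit.rz_touch {l r : ℕ} {N : NetB l r} {π cA cB A S B} (h : Sit N π cA cB A S B) :
    ∀ e ∈ gE, (e.1 ∈ S ∨ e.2 ∈ S) → e ∈ Rz N π cA cB :=
  fun e he ht => ⟨he, h.touch e he ht⟩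

/-- No bad situation occurs for the net. -/
def Good (X : NetS) : Prop :=
  ∀ (π : X.2.2.P → ℕ) (cA : Fin X.1 → Set Ct) (cB : Fin X.2.1 → Set Ct) (A S B : Set ℕ),
    Sit X.2.2 π cA cB A S B → (∀ i, i ∈ A ∨ i ∈ S ∨ i ∈ B → i < 9) →
    ∀ k ∈ cfgs, ¬ Bad k A S B (Rz X.2.2 π cA cB)

theorem good_leaf (X : NetS) (h : Nat.card X.2.2.P ≤ 2) : Good X := by
  intro π cA cB A S B hs _ k hk hb
  haveI := X.2.2.finP
  have hfin : S.Finite := hs.rng ▸ Set.finite_range π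
  have h3 := bad_leaf hk hb hfin
  have h4 : S.ncard = Nat.card X.2.2.P := by
    rw [← hs.rng, ← Set.image_univ, Set.ncard_image_of_injective _ hs.inj, Set.ncard_univ]
  omega

theorem castNet_rfl {k l : ℕ} (N : NetB k l) : castNet rfl rfl N = N := by
  cases N
  simp [castNet]

theorem good_comp {k n l : ℕ} (X : NetB k n) (Y : NetB n l) (hp : Pure X Y) (hn : n ≤ 2)
    (hX : Good ⟨k, n, X⟩) (hY : Good ⟨n, l, Y⟩) : Good ⟨k, l, comp X Y⟩ := by
  intro π cA cB A S B hs hU c hc hb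
  obtain ⟨πX, πY, mb, ma, SX, SY, sX, sY, rfl, hR⟩ := sit_seq hp hs
  rcases seq_step hc hn hb hU sX.dAS sY.dAS sY.dAB sY.dSB hR sX.rz_touch sY.rz_touch sX.covR
    with h | h
  · refine hX πX cA mb A SX (SY ∪ B) sX (fun i hi => hU i ?_) c hc h
    simp only [Set.mem_union] at hi ⊢
    tauto
  · refine hY πY ma cB (A ∪ SX) SY B sY (fun i hi => hU i ?_) c hc h
    simp only [Set.mem_union] at hi ⊢
    tauto

theorem good_seq (X Y : NetS) (h : X.2.1 = Y.1) (hp : Pure (castNet rfl h X.2.2) Y.2.2)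
    (hn : Y.1 ≤ 2) (hX : Good X) (hY : Good Y) : Good (seqS X Y) := by
  obtain ⟨k, n, X⟩ := X
  obtain ⟨n', l, Y⟩ := Y
  dsimp only at h
  subst h
  rw [castNet_rfl] at hp
  have e : seqS ⟨k, n, X⟩ ⟨n, l, Y⟩ = ⟨k, l, comp X Y⟩ := by
    refine (dif_pos (rfl : n = n)).trans ?_
    exact congrArg (fun Z => (⟨k, l, comp Z Y⟩ : NetS)) (castNet_rfl X)
  rw [e]
  exact good_comp X Y hp hn hX hY

theorem good_ten (X Y : NetS) (hl : X.1 + Y.1 ≤ 2) (hr : X.2.1 + Y.2.1 ≤ 2)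
    (hX : Good X) (hY : Good Y) : Good (tenS X Y) := by
  intro π cA cB A S B hs hU c hc hb
  have cl := hs.covL
  have cr := hs.covR
  obtain ⟨πX, πY, aX, aY, bX, bY, SX, SY, sX, sY, rfl, dXY, hR⟩ := sit_ten hs
  rcases ten_step hc hl hr hb hU hs.dAS hs.dAB hs.dSB dXY cl cr hR sX.rz_touch sY.rz_touch
    (fun e he => sX.rz_sub he) sX.covL sY.covL sX.covR sY.covR with ⟨c', hc', h⟩ | ⟨c', hc', h⟩
  · refine hX πX aX bX A SX B sX (fun i hi => hU i ?_) c' hc' h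
    simp only [Set.mem_union] at hi ⊢
    tauto
  · refine hY πY aY bY A SY B sY (fun i hi => hU i ?_) c' hc' h
    simp only [Set.mem_union] at hi ⊢
    tauto

theorem width_bd {V : Type} (A : V → NetS) (w : ℕ) (t : WExpr V) (h : HasWidth A w t) :
    (sem A t).1 ≤ w ∧ (sem A t).2.1 ≤ w := by
  cases t with
  | leaf x => exact ⟨h.1, h.2.2⟩
  | seq t₁ t₂ => exact h.2.2
  | ten t₁ t₂ => exact h.2.2

theorem good_sem {V : Type} (A : V → NetS) (w : ℕ) (hw : w < 3) (t : WExpr V) :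
    WT A t → PureExpr A t → HasWidth A w t → Good (sem A t) := by
  induction t with
  | leaf x =>
    intro _ _ h
    exact good_leaf _ (h.2.1.trans (by omega))
  | seq t₁ t₂ ih1 ih2 =>
    rintro ⟨w1, w2, w3⟩ ⟨p1, p2, p3⟩ ⟨h1, h2, h3⟩
    exact good_seq _ _ w3 (p3 w3) ((width_bd A w t₂ h2).1.trans (by omega))
      (ih1 w1 p1 h1) (ih2 w2 p2 h2)
  | ten t₁ t₂ ih1 ih2 =>
    rintro ⟨w1, w2⟩ ⟨p1, p2⟩ ⟨h1, h2, h3⟩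
    exact good_ten _ _ (h3.1.trans (by omega)) (h3.2.trans (by omega))
      (ih1 w1 p1 h1) (ih2 w2 p2 h2)

/-! ### The root -/

def code (p : Fin 3 × Fin 3) : ℕ := 3 * p.1.val + p.2.val

theorem code_inj : Function.Injective code := by
  rintro ⟨a, b⟩ ⟨c, d⟩ h
  simp only [code] at h
  ext <;> simp only <;> omega

theorem code_edge (e : (grid 3).T) : (code e.1.1, code e.1.2) ∈ gE := by
  have : ∀ e : (Fin 3 × Fin 3) × (Fin 3 × Fin 3),
      ((e.2.1 = e.1.1 ∧ (e.2.2 : ℕ) = (e.1.2 : ℕ) + 1) ∨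
        ((e.2.1 : ℕ) = (e.1.1 : ℕ) + 1 ∧ e.2.2 = e.1.2)) → (code e.1, code e.2) ∈ gE := by
    decide
  exact this e.1 e.2

theorem edge_code : ∀ f ∈ gE, ∃ e : (grid 3).T, (code e.1.1, code e.1.2) = f := by
  have : ∀ f ∈ gE, ∃ e : (Fin 3 × Fin 3) × (Fin 3 × Fin 3),
      ((e.2.1 = e.1.1 ∧ (e.2.2 : ℕ) = (e.1.2 : ℕ) + 1) ∨
        ((e.2.1 : ℕ) = (e.1.1 : ℕ) + 1 ∧ e.2.2 = e.1.2)) ∧ (code e.1, code e.2) = f := by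
    decide
  intro f hf
  obtain ⟨e, h1, h2⟩ := this f hf
  exact ⟨⟨e, h1⟩, h2⟩

theorem root_sit (N : NetB 0 0) (i : NetIso N (grid 3)) :
    Sit N (fun p => code (i.ep p)) (fun _ => ∅) (fun _ => ∅) ∅ {j | j < 9} ∅ := by
  have hfull : ∀ x, ∃ e : ℕ × ℕ, e = (code (i.et x).1.1, code (i.et x).1.2) ∧
      tc N (fun p => code (i.ep p)) x = ec e := by
    intro x
    refine ⟨_, rfl, ?_⟩
    have h1 := i.pre_eq x
    have h2 := i.post_eq x
    refine Prod.ext ?_ ?_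
    · show (fun p => code (i.ep p)) '' N.pre x = _
      have h3 : (fun p => code (i.ep p)) '' N.pre x = code '' ((grid 3).pre (i.et x)) :=
        (Set.image_image code i.ep _).symm.trans (congrArg (fun s => code '' s) h1.symm)
      exact h3.trans Set.image_singleton
    · show (fun p => code (i.ep p)) '' N.post x = _
      have h3 : (fun p => code (i.ep p)) '' N.post x = code '' ((grid 3).post (i.et x)) :=
        (Set.image_image code i.ep _).symm.trans (congrArg (fun s => code '' s) h2.symm)
      exact h3.trans Set.image_singleton
  have he : ∀ s : Set (Fin 0), s = ∅ := fun s => Set.eq_empty_of_isEmpty s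
  refine ⟨?_, ?_, Set.disjoint_left.2 (by simp), Set.disjoint_left.2 (by simp),
    Set.disjoint_left.2 (by simp), by simp, by simp, ?_, ?_⟩
  · exact code_inj.comp i.ep.injective
  · ext j
    constructor
    · rintro ⟨p, rfl⟩
      show code (i.ep p) < 9
      generalize i.ep p = q
      obtain ⟨a, b⟩ := q
      simp only [code]
      omega
    · intro hj
      have hj : j < 9 := hj
      refine ⟨i.ep.symm (⟨j / 3, by omega⟩, ⟨j % 3, by omega⟩), ?_⟩
      refine (congrArg code (i.ep.apply_symm_apply _)).trans ?_
      show 3 * (j / 3) + j % 3 = j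
      omega
  · rintro c ⟨x, a, ha, b, hb, rfl⟩
    rw [he (N.src x), ext_empty] at ha
    rw [he (N.tgt x), ext_empty] at hb
    obtain ⟨e, h1, h2⟩ := hfull x
    refine ⟨e, h1 ▸ code_edge _, ?_⟩
    rw [ha, hb, h2]
    simp
  · intro f hf _
    obtain ⟨t, ht⟩ := edge_code f hf
    obtain ⟨e, h1, h2⟩ := hfull (i.et.symm t)
    rw [Equiv.apply_symm_apply, ht] at h1
    subst h1
    refine ⟨i.et.symm t, ⊥, by rw [he (N.src _), ext_empty], ⊥, by rw [he (N.tgt _), ext_empty], ?_⟩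
    rw [h2]
    simp

theorem not_good_root (X : NetS) (h1 : X.1 = 0) (h2 : X.2.1 = 0)
    (hi : Iso (castNet h1 h2 X.2.2) (grid 3)) : ¬ Good X := by
  obtain ⟨k, l, N⟩ := X
  dsimp only at h1 h2
  subst h1 h2
  rw [castNet_rfl] at hi
  obtain ⟨i⟩ := hi
  intro hg
  have hs := root_sit N i
  refine hg _ _ _ _ _ _ hs (by simp) ⟨true, 9, 0, 0, 3⟩ (by simp [cfgs]) ?_
  refine ⟨fun j hj => by simp [hj], Or.inl rfl, ?_, ?_, Or.inl rfl, ?_⟩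
  · simp [cntC, chi]
  · simp [cntC, chi]
  · intro e he _
    exact hs.rz_touch e he (Or.inl (gE_lt e he).1)

/-- the grid net `G_3` has no pure wiring decomposition of
width strictly less than 3. -/
theorem grid3_no_pure_decomp_lt_three :
    ∀ (Var : Type) (A : Var → NetS) (t : WExpr Var) (w : ℕ), w < 3 →
      IsDecompOf A t (grid 3) → PureExpr A t → ¬ HasWidth A w t := by
  rintro Var A t w hw ⟨-, hWT, h1, h2, hi⟩ hp hwd
  exact not_good_root _ h1 h2 hi (good_sem A w hw t hWT hp hwd)

end NWB
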